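/- arXiv:0811.0208 — 6 statements merged into one kernel-verified Lean document; each statement's English description precedes it below -/
import Mathlib

section
/- Let X be a compact length space, Y ⊆ X a nonempty closed subset, F : Y → ℝ Lipschitz, ε > 0 and θ ∈ (−1,1). Then there exists exactly one bounded function u : X → ℝ with u = F on Y that is (θ,ε)-infinity harmonic on X∖Y. -/
open Set Metric Filter

noncomputable section

/-- A metric space is a **length space** if the distance between any two points equals the
infimum of the lengths of continuous paths joining them. -/
def IsLengthSpace (X : Type*) [MetricSpace X] : Prop :=
  ∀ x y : X, edist x y = ⨅ γ : Path x y, eVariationOn (fun t => γ t) Set.univ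

/-- `u` is `(θ, ε)`-infinity harmonic on `S`: for every `x ∈ S` the supremum and infimum of `u`
over the open ball `B_ε(x)` are finite and
`u(x) = ((1+θ)/2)·sup_{B_ε(x)} u + ((1−θ)/2)·inf_{B_ε(x)} u`. -/
def InfinityHarmonicOn {X : Type*} [MetricSpace X] (θ ε : ℝ) (S : Set X) (u : X → ℝ) : Prop :=
  ∀ x ∈ S, BddAbove (u '' ball x ε) ∧ BddBelow (u '' ball x ε) ∧
    u x = ((1 + θ) / 2) * sSup (u '' ball x ε) + ((1 - θ) / 2) * sInf (u '' ball x ε)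

/-- `φ` is a **β-exponential cone** centered at `x₀`:
`φ(x) = sgn(β)·A·(1 − e^{−β d(x₀,x)}) + B` (positive cone) or
`φ(x) = sgn(β)·A·(1 − e^{β d(x₀,x)}) + B` (negative cone), with `A ≥ 0`, `B ∈ ℝ`. -/
def IsExpCone {X : Type*} [MetricSpace X] (β : ℝ) (x₀ : X) (φ : X → ℝ) : Prop :=
  ∃ A B : ℝ, 0 ≤ A ∧
    ((∀ x, φ x = Real.sign β * A * (1 - Real.exp (-β * dist x₀ x)) + B) ∨
     (∀ x, φ x = Real.sign β * A * (1 - Real.exp (β * dist x₀ x)) + B))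

/-- Comparison with β-exponential cones **from above** on `X ∖ Y`. -/
def CECA {X : Type*} [MetricSpace X] (β : ℝ) (Y : Set X) (u : X → ℝ) : Prop :=
  ∀ V : Set X, IsOpen V → V ⊆ Yᶜ → (∃ r > 0, ∀ v ∈ V, ∀ y ∈ Y, r ≤ dist v y) →
    ∀ x₀ : X, ∀ φ : X → ℝ, IsExpCone β x₀ φ →
      (∀ x ∈ frontier (V \ {x₀}), u x ≤ φ x) → ∀ x ∈ V, u x ≤ φ x

/-- Comparison with β-exponential cones **from below** on `X ∖ Y`. -/
def CECB {X : Type*} [MetricSpace X] (β : ℝ) (Y : Set X) (u : X → ℝ) : Prop :=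
  ∀ V : Set X, IsOpen V → V ⊆ Yᶜ → (∃ r > 0, ∀ v ∈ V, ∀ y ∈ Y, r ≤ dist v y) →
    ∀ x₀ : X, ∀ φ : X → ℝ, IsExpCone β x₀ φ →
      (∀ x ∈ frontier (V \ {x₀}), φ x ≤ u x) → ∀ x ∈ V, φ x ≤ u x

/-- Comparison with β-exponential cones on `X ∖ Y`. -/
def CEC {X : Type*} [MetricSpace X] (β : ℝ) (Y : Set X) (u : X → ℝ) : Prop :=
  CECA β Y u ∧ CECB β Y u

open Classical in
/-- The modified metric `d^ε`: `d^ε(x,y) = ε + ε⌊d(x,y)/ε⌋` for `x ≠ y`, `d^ε(x,x) = 0`. -/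
noncomputable def dEps {X : Type*} [MetricSpace X] (ε : ℝ) (x y : X) : ℝ :=
  if x = y then 0 else ε + ε * (⌊dist x y / ε⌋ : ℝ)

/-- `d^ε(X) = sup_{x₁,x₂ ∈ X} d^ε(x₁,x₂)`. -/
noncomputable def dEpsDiam (X : Type*) [MetricSpace X] (ε : ℝ) : ℝ :=
  ⨆ p : X × X, dEps ε p.1 p.2

/-- `ρ` satisfies condition (⋆) for `β`: `ρ` is a smooth positive function on a neighbourhood of
`0` with `ρ(0) = 1`, `ρ′(0) = β`, whose logarithm is concave or convex. -/
def OddsCondition (β : ℝ) (ρ : ℝ → ℝ) : Prop :=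
  ∃ a : ℝ, 0 < a ∧ ContDiffOn ℝ (⊤ : ℕ∞) ρ (Ioo (-a) a) ∧ (∀ x ∈ Ioo (-a) a, 0 < ρ x) ∧
    ρ 0 = 1 ∧ deriv ρ 0 = β ∧
    (ConvexOn ℝ (Ioo (-a) a) (fun x => Real.log (ρ x)) ∨
     ConcaveOn ℝ (Ioo (-a) a) (fun x => Real.log (ρ x)))

end

/-- In a length space any two points are joined by a path. -/
lemma IsLengthSpace.preconnectedSpace {X : Type*} [MetricSpace X] (hX : IsLengthSpace X) :
    PreconnectedSpace X := by
  rcases isEmpty_or_nonempty X with hX' | hX'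
  · infer_instance
  have : PathConnectedSpace X := by
    refine ⟨hX', fun x y => ?_⟩
    by_contra h
    have : IsEmpty (Path x y) := not_nonempty_iff.mp h
    have hxy := hX x y
    rw [iInf_of_empty] at hxy
    exact edist_ne_top x y hxy
  infer_instance

/-- In a compact connected metric space, every point is reached from a given point by an `ε`-chain
of uniformly bounded length. -/
lemma exists_iterate_thickening_eq_univ {X : Type*} [MetricSpace X] [CompactSpace X]
    [PreconnectedSpace X] {ε : ℝ} (hε : 0 < ε) (x₀ : X) :
    ∃ n : ℕ, (thickening ε)^[n] {x₀} = univ := by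
  let U : ℕ → Set X := fun n => (thickening ε)^[n] {x₀}
  have hsucc (n : ℕ) : U (n + 1) = thickening ε (U n) := Function.iterate_succ_apply' _ _ _
  have hmono : Monotone U := monotone_nat_of_le_succ fun n => by
    rw [hsucc]; exact self_subset_thickening hε _
  have hunion : ⋃ n, U n = ⋃ n, U (n + 1) :=
    (hmono.iUnion_nat_add 1).symm
  have hopen (n : ℕ) : IsOpen (U (n + 1)) := by
    rw [hsucc]; exact isOpen_thickening
  have hclosed : IsClosed (⋃ n, U n) := by
    refine isClosed_of_closure_subset fun x hx => ?_
    obtain ⟨y, hy, hxy⟩ := Metric.mem_closure_iff.mp hx ε hε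
    obtain ⟨n, hn⟩ := mem_iUnion.mp hy
    refine mem_iUnion.mpr ⟨n + 1, ?_⟩
    rw [hsucc]
    exact mem_thickening_iff.mpr ⟨y, hn, hxy⟩
  have huniv : ⋃ n, U n = univ :=
    IsClopen.eq_univ ⟨hclosed, hunion ▸ isOpen_iUnion hopen⟩ ⟨x₀, mem_iUnion.mpr ⟨0, rfl⟩⟩
  obtain ⟨n, hn⟩ := isCompact_univ.elim_directed_cover (fun n => U (n + 1)) hopen
    (by rw [← hunion, huniv])
    (Monotone.directed_le fun a b hab => hmono (Nat.succ_le_succ hab))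
  exact ⟨n + 1, univ_subset_iff.mp hn⟩

/-- Propagation of near-maximality: if `w = v - u` almost attains its supremum `M` at `x` and `v x`
almost attains the largest asymptotic value `S` of `v` near the maximum of `w`, then the same holds
on the whole ball around `x`. -/
lemma InfinityHarmonicOn.exists_forall_ball_near_max {X : Type*} [MetricSpace X] {θ ε : ℝ}
    (hε : 0 < ε) (hθ : θ ∈ Ioo (-1 : ℝ) 1) {Y : Set X} {u v : X → ℝ}
    (hu : InfinityHarmonicOn θ ε Yᶜ u) (hv : InfinityHarmonicOn θ ε Yᶜ v)
    (huv : ∀ y ∈ Y, v y ≤ u y) {M S : ℝ} (hM : 0 < M) (hw : ∀ x, v x - u x ≤ M)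
    (hS : ∀ ρ > 0, ∃ η > 0, ∀ x, M - η < v x - u x → v x < S + ρ) {τ : ℝ} (hτ : 0 < τ) :
    ∃ η > 0, ∀ x, M - η < v x - u x → S - η < v x →
      ∀ z ∈ ball x ε, M - τ < v z - u z ∧ S - τ < v z := by
  obtain ⟨hθ₁, hθ₂⟩ := hθ
  obtain ⟨p, hp⟩ : ∃ p, p = (1 + θ) / 2 := ⟨_, rfl⟩
  obtain ⟨q, hq⟩ : ∃ q, q = (1 - θ) / 2 := ⟨_, rfl⟩
  have hp0 : 0 < p := by linarith
  have hq0 : 0 < q := by linarith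
  have hpq : p + q = 1 := by linarith
  -- everything below is scaled by `p * q` to avoid divisions
  obtain ⟨σ, hσ0, hστ⟩ : ∃ σ > 0, 8 * σ ≤ p * q * τ :=
    ⟨p * q * τ / 8, by positivity, by linarith⟩
  obtain ⟨η₀, hη₀, hS'⟩ := hS σ hσ0
  obtain ⟨η, hη, hησ, hηM, hηη₀⟩ : ∃ η > 0, η ≤ σ ∧ η ≤ M ∧ 2 * η ≤ p * η₀ :=
    ⟨min σ (min M (p * η₀ / 2)), by positivity, min_le_left _ _,
      (min_le_right _ _).trans (min_le_left _ _), by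
        have := (min_le_right σ (min M (p * η₀ / 2))).trans (min_le_right _ _)
        linarith⟩
  refine ⟨η, hη, fun x hwx hvx z hz => ?_⟩
  have hxY : x ∈ Yᶜ := fun hxY => by linarith [huv x hxY]
  obtain ⟨hua, -, hux⟩ := hu x hxY
  obtain ⟨hva, hvb, hvx'⟩ := hv x hxY
  rw [← hp, ← hq] at hux hvx'
  have hne (f : X → ℝ) : (f '' ball x ε).Nonempty := ⟨f x, mem_image_of_mem _ (mem_ball_self hε)⟩
  have huS {y : X} (hy : y ∈ ball x ε) : u y ≤ sSup (u '' ball x ε) :=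
    le_csSup hua (mem_image_of_mem _ hy)
  have hvS {y : X} (hy : y ∈ ball x ε) : v y ≤ sSup (v '' ball x ε) :=
    le_csSup hva (mem_image_of_mem _ hy)
  have hvI {y : X} (hy : y ∈ ball x ε) : sInf (v '' ball x ε) ≤ v y :=
    csInf_le hvb (mem_image_of_mem _ hy)
  have hinf : sInf (v '' ball x ε) - M ≤ sInf (u '' ball x ε) := by
    refine le_csInf (hne u) ?_
    rintro _ ⟨y, hy, rfl⟩
    linarith [hw y, hvI hy]
  obtain ⟨_, ⟨y, hy, rfl⟩, hyS⟩ := exists_lt_of_lt_csSup (hne v)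
    (sub_lt_self (sSup (v '' ball x ε)) hη)
  have huSy := huS hy
  have huSz := huS hz
  have hvIz := hvI hz
  have hvSx := hvS (mem_ball_self hε)
  generalize sSup (u '' ball x ε) = su at *
  generalize sInf (u '' ball x ε) = iu at *
  generalize sSup (v '' ball x ε) = sv at *
  generalize sInf (v '' ball x ε) = iv at *
  have hp1 : p ≤ 1 := by linarith
  have hq1 : q ≤ 1 := by linarith
  -- the suprema of `u` and `v` differ by almost `M`
  have hsup : p * M - η < p * (sv - su) := by
    have : q * (iv - iu) ≤ q * M := mul_le_mul_of_nonneg_left (by linarith) hq0.le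
    have : M = p * M + q * M := by rw [← add_mul, hpq, one_mul]
    linarith
  have hwy : M - η₀ < v y - u y := by
    have h1 : p * (sv - su - η) < p * (v y - u y) := mul_lt_mul_of_pos_left (by linarith) hp0
    have h2 : p * η ≤ η := mul_le_of_le_one_left hη.le hp1
    exact lt_of_mul_lt_mul_left (by linarith : p * (M - η₀) < p * (v y - u y)) hp0.le
  have hsv : sv < S + 2 * σ := by linarith [hS' y hwy]
  -- hence `v` has small oscillation on the ball
  have hosc : q * (sv - iv) ≤ 3 * σ := by
    have h1 : v x = sv - q * (sv - iv) := by
      rw [hvx', eq_sub_of_add_eq hpq]; ring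
    linarith
  have hosc' : p * (q * (sv - iv)) ≤ p * (3 * σ) := mul_le_mul_of_nonneg_left hosc hp0.le
  have hpσ : p * (3 * σ) ≤ 3 * σ := mul_le_of_le_one_left (by positivity) hp1
  have hqη : q * (p * M - η) ≤ q * (p * (sv - su)) := mul_le_mul_of_nonneg_left hsup.le hq0.le
  have hqη' : q * η ≤ η := mul_le_of_le_one_left hη.le hq1
  have hpq0 : 0 < p * q := mul_pos hp0 hq0
  have hpq1 : p * q * σ ≤ σ := mul_le_of_le_one_left hσ0.le (by nlinarith)
  constructor
  · have : p * q * (iv - su) ≤ p * q * (v z - u z) :=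
      mul_le_mul_of_nonneg_left (by linarith) hpq0.le
    refine lt_of_mul_lt_mul_left (a := p * q) ?_ hpq0.le
    linarith
  · have h1 : p * q * iv ≤ p * q * v z := mul_le_mul_of_nonneg_left hvIz hpq0.le
    have h2 : p * q * (S - σ) ≤ p * q * sv :=
      mul_le_mul_of_nonneg_left (by linarith) hpq0.le
    refine lt_of_mul_lt_mul_left (a := p * q) ?_ hpq0.le
    linarith

/-- Comparison principle for bounded infinity harmonic functions. -/
lemma InfinityHarmonicOn.le_of_le_on {X : Type*} [MetricSpace X] [CompactSpace X]
    [PreconnectedSpace X] {θ ε : ℝ} (hε : 0 < ε) (hθ : θ ∈ Ioo (-1 : ℝ) 1) {Y : Set X}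
    (hY : Y.Nonempty) {u v : X → ℝ} (hub : ∃ C, ∀ x, |u x| ≤ C) (hvb : ∃ C, ∀ x, |v x| ≤ C)
    (hu : InfinityHarmonicOn θ ε Yᶜ u) (hv : InfinityHarmonicOn θ ε Yᶜ v)
    (huv : ∀ y ∈ Y, v y ≤ u y) (x : X) : v x ≤ u x := by
  by_contra! hx
  obtain ⟨A, hA⟩ := hub
  obtain ⟨B, hB⟩ := hvb
  obtain ⟨y₀, hy₀⟩ := hY
  have hbdd : BddAbove (range fun x => v x - u x) := by
    refine ⟨B + A, ?_⟩
    rintro _ ⟨z, rfl⟩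
    linarith [(abs_le.mp (hA z)).1, (abs_le.mp (hB z)).2]
  obtain ⟨M, hMdef⟩ : ∃ M, M = sSup (range fun x => v x - u x) := ⟨_, rfl⟩
  have hw (z : X) : v z - u z ≤ M := hMdef ▸ le_csSup hbdd (mem_range_self z)
  have hM : 0 < M := by linarith [hw x]
  have hnear {η : ℝ} (hη : 0 < η) : ∃ z, M - η < v z - u z := by
    obtain ⟨_, ⟨z, rfl⟩, hz⟩ := exists_lt_of_lt_csSup (⟨_, mem_range_self x⟩ :
      (range fun x => v x - u x).Nonempty) (sub_lt_self _ hη)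
    exact ⟨z, hMdef ▸ hz⟩
  -- the largest asymptotic value of `v` where `v - u` approaches its supremum
  let E : Set ℝ := {s | ∃ η > 0, ∀ z, M - η < v z - u z → v z ≤ s}
  have hEne : E.Nonempty := ⟨B, 1, one_pos, fun z _ => (abs_le.mp (hB z)).2⟩
  have hEbdd : BddBelow E := by
    refine ⟨-B, ?_⟩
    rintro s ⟨η, hη, hs⟩
    obtain ⟨z, hz⟩ := hnear hη
    exact (abs_le.mp (hB z)).1.trans (hs z hz)
  have hS : ∀ ρ > 0, ∃ η > 0, ∀ z, M - η < v z - u z → v z < sInf E + ρ := by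
    intro ρ hρ
    obtain ⟨s, ⟨η, hη, hs⟩, hsρ⟩ := exists_lt_of_csInf_lt hEne (lt_add_of_pos_right (sInf E) hρ)
    exact ⟨η, hη, fun z hz => (hs z hz).trans_lt hsρ⟩
  have hS' {η : ℝ} (hη : 0 < η) : ∃ z, M - η < v z - u z ∧ sInf E - η < v z := by
    by_contra! h
    linarith [csInf_le hEbdd ⟨η, hη, h⟩]
  have hchain (n : ℕ) : ∃ η > 0, ∀ z ∈ (thickening ε)^[n] {y₀},
      M - η < v z - u z → sInf E - η < v z → M - M < v y₀ - u y₀ := by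
    induction n with
    | zero =>
      refine ⟨M, hM, fun z hz h _ => ?_⟩
      rwa [mem_singleton_iff.mp hz] at h
    | succ n ih =>
      obtain ⟨τ, hτ, ih⟩ := ih
      obtain ⟨η, hη, h⟩ := hu.exists_forall_ball_near_max hε hθ hv huv hM hw hS hτ
      refine ⟨η, hη, fun z hz hz₁ hz₂ => ?_⟩
      rw [Function.iterate_succ_apply'] at hz
      obtain ⟨z', hz', hd⟩ := mem_thickening_iff.mp hz
      obtain ⟨h₁, h₂⟩ := h z hz₁ hz₂ z' (mem_ball'.mpr hd)
      exact ih z' hz' h₁ h₂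
  obtain ⟨n, hn⟩ := exists_iterate_thickening_eq_univ hε y₀
  obtain ⟨η, hη, h⟩ := hchain n
  obtain ⟨z, hz₁, hz₂⟩ := hS' hη
  linarith [h z (hn ▸ mem_univ z) hz₁ hz₂, huv y₀ hy₀]

/-- Bounded boundary data has a bounded infinity harmonic extension, by the Knaster–Tarski
fixed point theorem. -/
lemma exists_infinityHarmonicOn_extension {X : Type*} [MetricSpace X] {θ ε : ℝ} (hε : 0 < ε)
    (hθ : θ ∈ Ioo (-1 : ℝ) 1) {Y : Set X} {F : Y → ℝ} {C : ℝ} (hC : 0 ≤ C)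
    (hF : ∀ y, |F y| ≤ C) :
    ∃ u : X → ℝ, (∀ x, |u x| ≤ C) ∧ (∀ y : Y, u y = F y) ∧ InfinityHarmonicOn θ ε Yᶜ u := by
  classical
  obtain ⟨hθ₁, hθ₂⟩ := hθ
  let I := Icc (-C) C
  have : Fact (-C ≤ C) := ⟨neg_le_self hC⟩
  let : CompleteLattice I := Icc.completeLattice
  have hne (f : X → I) (x : X) : ((fun z => (f z : ℝ)) '' ball x ε).Nonempty :=
    ⟨_, mem_image_of_mem _ (mem_ball_self hε)⟩
  have hba (f : X → I) (x : X) : BddAbove ((fun z => (f z : ℝ)) '' ball x ε) :=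
    ⟨C, by rintro _ ⟨z, -, rfl⟩; exact (f z).2.2⟩
  have hbb (f : X → I) (x : X) : BddBelow ((fun z => (f z : ℝ)) '' ball x ε) :=
    ⟨-C, by rintro _ ⟨z, -, rfl⟩; exact (f z).2.1⟩
  have hmem (f : X → I) (x : X) :
      (1 + θ) / 2 * sSup ((fun z => (f z : ℝ)) '' ball x ε) +
        (1 - θ) / 2 * sInf ((fun z => (f z : ℝ)) '' ball x ε) ∈ I := by
    have hx := mem_image_of_mem (fun z => (f z : ℝ)) (mem_ball_self (x := x) hε)
    refine convex_Icc (-C) C (a := (1 + θ) / 2) (b := (1 - θ) / 2) ?_ ?_ (by linarith) (by linarith) (by ring)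
    · exact ⟨(f x).2.1.trans (le_csSup (hba f x) hx),
        csSup_le (hne f x) (by rintro _ ⟨z, -, rfl⟩; exact (f z).2.2)⟩
    · exact ⟨le_csInf (hne f x) (by rintro _ ⟨z, -, rfl⟩; exact (f z).2.1),
        (csInf_le (hbb f x) hx).trans (f x).2.2⟩
  let T : (X → I) →o (X → I) :=
    { toFun := fun f x => if h : x ∈ Y then ⟨F ⟨x, h⟩, abs_le.mp (hF _)⟩ else ⟨_, hmem f x⟩
      monotone' := by
        intro f g hfg x
        have hfg' (z : X) : (f z : ℝ) ≤ g z := hfg z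
        by_cases h : x ∈ Y
        · simp only [h, dite_true]; exact le_rfl
        · simp only [h, dite_false]
          refine Subtype.mk_le_mk.mpr (add_le_add ?_ ?_)
          · refine mul_le_mul_of_nonneg_left (csSup_le (hne f x) ?_) (by linarith)
            rintro _ ⟨z, hz, rfl⟩
            exact (hfg' z).trans (le_csSup (hba g x) ⟨z, hz, rfl⟩)
          · refine mul_le_mul_of_nonneg_left (le_csInf (hne g x) ?_) (by linarith)
            rintro _ ⟨z, hz, rfl⟩
            exact (csInf_le (hbb f x) ⟨z, hz, rfl⟩).trans (hfg' z) }
  have hT (x : X) : T T.lfp x = T.lfp x := congrFun T.map_lfp x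
  refine ⟨fun x => T.lfp x, fun x => abs_le.mpr (T.lfp x).2, fun y => ?_, fun x hx => ?_⟩
  · change (T.lfp y : ℝ) = F y
    rw [← hT y]
    change ((if h : (y : X) ∈ Y then _ else _ : I) : ℝ) = _
    rw [dif_pos y.2]
  · refine ⟨hba _ x, hbb _ x, ?_⟩
    change (T.lfp x : ℝ) = _
    rw [← hT x]
    change ((if h : x ∈ Y then _ else _ : I) : ℝ) = _
    rw [dif_neg hx]

/-- On a compact length space `X` with nonempty closed `Y ⊆ X` and Lipschitz
`F : Y → ℝ`, for any `ε > 0` and `θ ∈ (−1,1)` there is exactly one bounded function `u : X → ℝ`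
with `u = F` on `Y` that is `(θ,ε)`-infinity harmonic on `X∖Y`. -/
theorem exists_unique_infinity_harmonic_extension
    {X : Type*} [MetricSpace X] [CompactSpace X] (hX : IsLengthSpace X)
    (Y : Set X) (hYne : Y.Nonempty) (hYcl : IsClosed Y)
    (F : Y → ℝ) (K : NNReal) (hF : LipschitzWith K F)
    (ε θ : ℝ) (hε : 0 < ε) (hθ : θ ∈ Set.Ioo (-1 : ℝ) 1) :
    ∃! u : X → ℝ, (∃ C : ℝ, ∀ x, |u x| ≤ C) ∧ (∀ y : Y, u y = F y) ∧
      InfinityHarmonicOn θ ε Yᶜ u := by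
  have := hX.preconnectedSpace
  have : CompactSpace Y := isCompact_iff_compactSpace.mp hYcl.isCompact
  obtain ⟨C, hC⟩ := isCompact_univ.exists_bound_of_continuousOn hF.continuous.continuousOn
  have hFC (y : Y) : |F y| ≤ C := hC y (mem_univ y)
  have hC0 : 0 ≤ C := (abs_nonneg _).trans (hFC ⟨_, hYne.some_mem⟩)
  obtain ⟨u, hub, huF, hu⟩ := exists_infinityHarmonicOn_extension hε hθ hC0 hFC
  refine ⟨u, ⟨⟨C, hub⟩, huF, hu⟩, ?_⟩
  rintro v ⟨hvb, hvF, hv⟩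
  have hvu : ∀ y ∈ Y, v y = u y := fun y hy => (hvF ⟨y, hy⟩).trans (huF ⟨y, hy⟩).symm
  funext x
  exact le_antisymm
    (hu.le_of_le_on hε hθ hYne ⟨C, hub⟩ hvb hv (fun y hy => (hvu y hy).le) x)
    (hv.le_of_le_on hε hθ hYne hvb ⟨C, hub⟩ hu (fun y hy => (hvu y hy).ge) x)
end

section
/- Let X be a compact length space, Y ⊆ X a nonempty closed subset, F : Y → ℝ Lipschitz with Lipschitz constant Lip_Y F, ε > 0 and θ ∈ [0,1). Let u be a bounded function on X extending F that is (θ,ε)-infinity harmonic on X∖Y. Then for every x ∈ X and y ∈ Y: u(x) ≥ F(y) − (2ε + d^ε(x,y)) · Lip_Y F. -/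
open Set Metric Filter

/-- In a length space, points can be found between two given points, splitting any strict upper
bound on their distance. -/
lemma IsLengthSpace.exists_dist_lt_dist_lt {X : Type*} [MetricSpace X] (hX : IsLengthSpace X)
    {x y : X} {a b : ℝ} (ha : 0 < a) (hb : 0 < b) (h : dist x y < a + b) :
    ∃ z, dist x z < a ∧ dist z y < b := by
  rcases lt_or_ge (dist x y) a with hxa | hxa
  · exact ⟨y, hxa, by simpa using hb⟩
  have hlt : ⨅ γ : Path x y, eVariationOn (fun t => γ t) Set.univ < ENNReal.ofReal (a + b) := by
    rw [← hX x y, edist_dist]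
    exact (ENNReal.ofReal_lt_ofReal_iff (by positivity)).2 h
  obtain ⟨γ, hγ⟩ := iInf_lt_iff.1 hlt
  set L := (eVariationOn (fun t => γ t) Set.univ).toReal with hL
  have hfin : eVariationOn (fun t => γ t) Set.univ ≠ ⊤ := hγ.ne_top
  have hLab : L < a + b := ENNReal.toReal_lt_of_lt_ofReal hγ
  have hsplit : ∀ t, dist x (γ t) + dist (γ t) y ≤ L := by
    intro t
    have hvar : edist (γ 0) (γ t) + edist (γ t) (γ 1) ≤ eVariationOn (fun t => γ t) Set.univ :=
      calc edist (γ 0) (γ t) + edist (γ t) (γ 1)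
          ≤ eVariationOn (fun t => γ t) (Iic t) + eVariationOn (fun t => γ t) (Ici t) :=
            add_le_add (eVariationOn.edist_le _ t.2.1 self_mem_Iic)
              (eVariationOn.edist_le _ self_mem_Ici t.2.2)
        _ ≤ eVariationOn (fun t => γ t) (Iic t ∪ Ici t) :=
            eVariationOn.add_le_union _ fun _ hs _ hr => le_trans hs hr
        _ ≤ _ := eVariationOn.mono _ (subset_univ _)
    rw [γ.source, γ.target, edist_dist, edist_dist,
      ← ENNReal.ofReal_add dist_nonneg dist_nonneg] at hvar
    exact (ENNReal.ofReal_le_iff_le_toReal hfin).1 hvar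
  obtain ⟨r, hr, hra⟩ : ∃ r, max 0 (L - b) < r ∧ r < a :=
    exists_between (max_lt ha (by linarith))
  have hr0 : 0 < r := (le_max_left _ _).trans_lt hr
  have hrL : L - b < r := (le_max_right _ _).trans_lt hr
  obtain ⟨t, ht⟩ : ∃ t, dist x (γ t) = r := by
    apply mem_range_of_exists_le_of_exists_ge (f := fun t => dist x (γ t)) (by fun_prop)
    · exact ⟨0, by simpa using hr0.le⟩
    · exact ⟨1, by simpa using (hra.trans_le hxa).le⟩
  exact ⟨γ t, by rw [ht]; exact hra, by linarith [hsplit t]⟩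

section dEps

variable {X : Type*} [MetricSpace X] {ε : ℝ}

lemma dEps_self (x : X) : dEps ε x x = 0 := by simp [dEps]

lemma dEps_of_ne {x y : X} (h : x ≠ y) : dEps ε x y = ε + ε * (⌊dist x y / ε⌋ : ℝ) := by
  simp [dEps, h]

lemma dEps_le_iff (hε : 0 < ε) {x y : X} (h : x ≠ y) (n : ℤ) :
    dEps ε x y ≤ ε * n ↔ dist x y < ε * n := by
  rw [dEps_of_ne h, ← mul_one_add, mul_le_mul_iff_right₀ hε, ← div_lt_iff₀' hε, ← Int.floor_lt,
    ← Int.add_one_le_iff, add_comm]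
  norm_cast

lemma dist_le_dEps (hε : 0 < ε) (x y : X) : dist x y ≤ dEps ε x y := by
  by_cases h : x = y
  · simp [h, dEps_self]
  · rw [dEps_of_ne h, ← mul_one_add, ← div_le_iff₀' hε, add_comm]
    exact (Int.lt_floor_add_one _).le

lemma dEps_nonneg (hε : 0 < ε) (x y : X) : 0 ≤ dEps ε x y :=
  dist_nonneg.trans (dist_le_dEps hε x y)

lemma dEps_le_dist_add (hε : 0 < ε) (x y : X) : dEps ε x y ≤ dist x y + ε := by
  by_cases h : x = y
  · simp [h, dEps_self, hε.le]
  · have := mul_le_mul_of_nonneg_left (Int.floor_le (dist x y / ε)) hε.le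
    rw [mul_div_cancel₀ _ hε.ne'] at this
    rw [dEps_of_ne h]
    linarith

lemma dEps_eq_mul {x y : X} (h : x ≠ y) :
    dEps ε x y = ε * ((⌊dist x y / ε⌋ + 1 : ℤ) : ℝ) := by
  rw [dEps_of_ne h]; push_cast; ring

lemma dEps_le_add_of_dist_lt (hε : 0 < ε) {x y z : X} (h : x ≠ y) (hz : dist x z < ε) :
    dEps ε z y ≤ dEps ε x y + ε := by
  by_cases hzy : z = y
  · rw [hzy, dEps_self]
    exact add_nonneg (dEps_nonneg hε x y) hε.le
  have hx := dEps_eq_mul (ε := ε) h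
  have hlt := (dEps_le_iff hε h _).1 hx.le
  have key := (dEps_le_iff hε hzy (⌊dist x y / ε⌋ + 1 + 1)).2 (by
    have := dist_triangle_left z y x
    push_cast at hlt ⊢
    linarith)
  push_cast at key hx
  linarith

lemma IsLengthSpace.exists_dEps_add_le (hX : IsLengthSpace X) (hε : 0 < ε) {x y : X}
    (h : x ≠ y) : ∃ z, dist x z < ε ∧ dEps ε z y + ε ≤ dEps ε x y := by
  rcases lt_or_ge (dist x y) ε with hlt | hge
  · refine ⟨y, hlt, ?_⟩
    rw [dEps_self, dEps_of_ne h]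
    have : (0 : ℝ) ≤ ⌊dist x y / ε⌋ := by exact_mod_cast Int.floor_nonneg.2 (by positivity)
    have := mul_nonneg hε.le this
    linarith
  have hx := dEps_eq_mul (ε := ε) h
  have hd := (dEps_le_iff hε h _).1 hx.le
  have hfl : (1 : ℝ) ≤ ⌊dist x y / ε⌋ := by
    exact_mod_cast Int.le_floor.2 (by simpa using (one_le_div₀ hε).2 hge)
  have hb : 0 < ε * (⌊dist x y / ε⌋ : ℝ) := by positivity
  push_cast at hx hd
  obtain ⟨z, hxz, hzy⟩ := hX.exists_dist_lt_dist_lt (x := x) (y := y) hε hb (by linarith)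
  refine ⟨z, hxz, ?_⟩
  by_cases hzy' : z = y
  · rw [hzy', dEps_self]; linarith
  · linarith [(dEps_le_iff hε hzy' _).2 hzy]

end dEps

/-- A bounded infinity harmonic function with bias `θ ∈ [0, 1)` lies above the cone
`B - K * dEps ε · y` as soon as it does so on `Y ∋ y`. -/
lemma InfinityHarmonicOn.sub_mul_dEps_le {X : Type*} [MetricSpace X] [CompactSpace X]
    (hX : IsLengthSpace X) {Y : Set X} {ε θ : ℝ} (hε : 0 < ε) (hθ : θ ∈ Set.Ico (0 : ℝ) 1)
    {u : X → ℝ} (hub : BddBelow (range u)) (huh : InfinityHarmonicOn θ ε Yᶜ u)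
    {B K : ℝ} (hK : 0 ≤ K) {y : X} (hy : y ∈ Y) (hY : ∀ z ∈ Y, B - K * dEps ε z y ≤ u z) (x : X) :
    B - K * dEps ε x y ≤ u x := by
  obtain ⟨hθ0, hθ1⟩ := hθ
  set f : X → ℝ := fun z => u z - (B - K * dEps ε z y) with hf
  have hfb : BddBelow (range f) := by
    obtain ⟨C, hC⟩ := hub
    refine ⟨C - B, ?_⟩
    rintro _ ⟨z, rfl⟩
    have := mul_nonneg hK (dEps_nonneg hε z y)
    have := hC (mem_range_self z)
    simp only [hf]
    linarith
  set m : ℝ := ⨅ z, f z with hm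
  have hmf : ∀ z, m ≤ f z := fun z => ciInf_le hfb z
  suffices hm0 : 0 ≤ m by linarith [hmf x]
  by_contra! hneg
  have hstep : ∀ x, x ∉ Y → ∀ z, dist x z < ε → dEps ε z y + ε ≤ dEps ε x y →
      (1 + θ) / 2 * (f z - m) ≤ f x - m := by
    intro x hx z hxz hz
    have hxy : x ≠ y := fun h => hx (h ▸ hy)
    obtain ⟨ha, -, he⟩ := huh x hx
    have hzball : z ∈ ball x ε := by rwa [mem_ball, dist_comm]
    have hsup : u z ≤ sSup (u '' ball x ε) := le_csSup ha (mem_image_of_mem u hzball)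
    have hinf : m + B - K * (dEps ε x y + ε) ≤ sInf (u '' ball x ε) := by
      refine le_csInf ⟨_, mem_image_of_mem u hzball⟩ ?_
      rintro _ ⟨v, hv, rfl⟩
      have := mul_le_mul_of_nonneg_left
        (dEps_le_add_of_dist_lt hε hxy (mem_ball'.1 hv)) hK
      have := hmf v
      simp only [hf] at this
      linarith
    have h1 := mul_le_mul_of_nonneg_left hsup (show 0 ≤ (1 + θ) / 2 by linarith)
    have h2 := mul_le_mul_of_nonneg_left hinf (show 0 ≤ (1 - θ) / 2 by linarith)
    have h3 := mul_le_mul_of_nonneg_left (mul_le_mul_of_nonneg_left hz hK)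
      (show 0 ≤ (1 + θ) / 2 by linarith)
    have h4 := mul_nonneg hθ0 (mul_nonneg hK hε.le)
    simp only [hf]
    linarith
  have hα0 : 0 < (1 + θ) / 2 := by linarith
  have hiter : ∀ n : ℕ, ∀ x, dEps ε x y ≤ n * ε → ((1 + θ) / 2) ^ n * (-m) ≤ f x - m := by
    have hbdry : ∀ n : ℕ, ∀ x ∈ Y, ((1 + θ) / 2) ^ n * (-m) ≤ f x - m := by
      intro n x hx
      have h1 : ((1 + θ) / 2) ^ n ≤ 1 := pow_le_one₀ hα0.le (by linarith)
      have h2 : 0 ≤ f x := sub_nonneg.2 (hY x hx)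
      nlinarith
    intro n
    induction n with
    | zero =>
      intro x hx
      refine hbdry 0 x ?_
      have : dist x y ≤ 0 := (dist_le_dEps hε x y).trans (by simpa using hx)
      rwa [dist_le_zero.1 this]
    | succ n ih =>
      intro x hx
      by_cases hxY : x ∈ Y
      · exact hbdry _ x hxY
      obtain ⟨z, hxz, hz⟩ := hX.exists_dEps_add_le hε (fun h : x = y => hxY (h ▸ hy))
      push_cast at hx
      have := mul_le_mul_of_nonneg_left (ih z (by linarith)) hα0.le
      rw [pow_succ']
      linarith [hstep x hxY z hxz hz]
  obtain ⟨N, hN⟩ := exists_nat_ge ((diam (univ : Set X) + ε) / ε)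
  have hpos : 0 < ((1 + θ) / 2) ^ N * (-m) := mul_pos (pow_pos hα0 N) (by linarith)
  have : Nonempty X := ⟨y⟩
  have hle : m + ((1 + θ) / 2) ^ N * (-m) ≤ m := by
    refine le_ciInf fun x => ?_
    have hd : dist x y ≤ diam (univ : Set X) :=
      dist_le_diam_of_mem isCompact_univ.isBounded (mem_univ x) (mem_univ y)
    have := hiter N x (by linarith [dEps_le_dist_add hε x y, (div_le_iff₀ hε).1 hN])
    linarith
  linarith

/-- If `u` is a bounded `(θ,ε)`-infinity harmonic extension of `F` with
`θ ∈ [0,1)`, then for every `x ∈ X` and `y ∈ Y`: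
`u(x) ≥ F(y) − (2ε + d^ε(x,y))·Lip_Y F`. -/
theorem infinity_harmonic_lower_bound
    {X : Type*} [MetricSpace X] [CompactSpace X] (hX : IsLengthSpace X)
    (Y : Set X) (hYne : Y.Nonempty) (hYcl : IsClosed Y)
    (F : Y → ℝ) (K : NNReal) (hF : LipschitzWith K F)
    (ε θ : ℝ) (hε : 0 < ε) (hθ : θ ∈ Set.Ico (0 : ℝ) 1)
    (u : X → ℝ) (hub : ∃ C : ℝ, ∀ x, |u x| ≤ C) (hue : ∀ y : Y, u y = F y)
    (huh : InfinityHarmonicOn θ ε Yᶜ u) :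
    ∀ (x : X) (y : Y), F y - (2 * ε + dEps ε x (y : X)) * (K : ℝ) ≤ u x := by
  intro x y
  have hbd : BddBelow (range u) := by
    obtain ⟨C, hC⟩ := hub
    exact ⟨-C, by rintro _ ⟨z, rfl⟩; exact (abs_le.1 (hC z)).1⟩
  have hcone : ∀ z ∈ Y, F y - K * dEps ε z y ≤ u z := by
    intro z hz
    have h1 := hF.dist_le_mul y ⟨z, hz⟩
    have h2 := mul_le_mul_of_nonneg_left (dist_le_dEps hε z (y : X)) K.2
    rw [Real.dist_eq, Subtype.dist_eq, dist_comm] at h1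
    have h3 := (le_abs_self _).trans h1
    have h4 : u z = F ⟨z, hz⟩ := hue ⟨z, hz⟩
    simp only [NNReal.val_eq_coe] at h2
    linarith
  have h := huh.sub_mul_dEps_le hX hε hθ hbd K.2 y.2 hcone x
  have := mul_nonneg hε.le K.2
  simp only [NNReal.val_eq_coe] at h this
  linarith
end

section
/- Let X be a compact length space, Y ⊆ X a nonempty closed subset, F : Y → ℝ Lipschitz, β > 0, and let ρ satisfy condition (⋆) for β with associated bias θ(ε) = (ρ(ε)−1)/(ρ(ε)+1). For each n ∈ ℕ let u^{ε/2ⁿ} be the unique bounded (θ(ε/2ⁿ), ε/2ⁿ)-infinity harmonic extension of F. Then for every sufficiently small ε > 0 the sequence (u^{ε/2ⁿ})_{n∈ℕ} converges uniformly on X as n → ∞. -/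
open Set Metric Filter

noncomputable section

namespace DyadicConvergence

variable {X : Type*}

/-- `u` is a bounded function. -/
def IsBdd (u : X → ℝ) : Prop := ∃ C : ℝ, ∀ x, |u x| ≤ C

lemma IsBdd.bddAbove {u : X → ℝ} (hu : IsBdd u) (s : Set X) : BddAbove (u '' s) := by
  obtain ⟨C, hC⟩ := hu
  exact ⟨C, by rintro _ ⟨x, -, rfl⟩; exact (abs_le.1 (hC x)).2⟩

lemma IsBdd.bddBelow {u : X → ℝ} (hu : IsBdd u) (s : Set X) : BddBelow (u '' s) := by
  obtain ⟨C, hC⟩ := hu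
  exact ⟨-C, by rintro _ ⟨x, -, rfl⟩; exact (abs_le.1 (hC x)).1⟩

lemma IsBdd.neg {u : X → ℝ} (hu : IsBdd u) : IsBdd (-u) := by
  obtain ⟨C, hC⟩ := hu
  exact ⟨C, fun x => by simpa using hC x⟩

lemma image_neg_eq (u : X → ℝ) (s : Set X) : (-u) '' s = -(u '' s) := by
  rw [← Set.image_neg_eq_neg, Set.image_image]
  rfl

lemma IsBdd.sub {u v : X → ℝ} (hu : IsBdd u) (hv : IsBdd v) : IsBdd (fun x => u x - v x) := by
  obtain ⟨C, hC⟩ := hu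
  obtain ⟨D, hD⟩ := hv
  exact ⟨C + D, fun x => (abs_sub _ _).trans (add_le_add (hC x) (hD x))⟩

variable [MetricSpace X]

/-- Supremum of `u` over the open ball of radius `δ` around `x`. -/
def ballSup (u : X → ℝ) (δ : ℝ) (x : X) : ℝ := sSup (u '' ball x δ)

/-- Infimum of `u` over the open ball of radius `δ` around `x`. -/
def ballInf (u : X → ℝ) (δ : ℝ) (x : X) : ℝ := sInf (u '' ball x δ)

/-- `u` is a subsolution on `S` of the game with step `δ` and odds `ρ`. -/
def IsSub (ρ δ : ℝ) (S : Set X) (u : X → ℝ) : Prop :=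
  ∀ x ∈ S, (1 + ρ) * u x ≤ ρ * ballSup u δ x + ballInf u δ x

/-- `u` is a supersolution on `S` of the game with step `δ` and odds `ρ`. -/
def IsSuper (ρ δ : ℝ) (S : Set X) (u : X → ℝ) : Prop :=
  ∀ x ∈ S, ρ * ballSup u δ x + ballInf u δ x ≤ (1 + ρ) * u x

lemma IsBdd.le_ballSup {u : X → ℝ} (hu : IsBdd u) {δ : ℝ} {x y : X} (h : dist y x < δ) :
    u y ≤ ballSup u δ x :=
  le_csSup (hu.bddAbove _) ⟨y, h, rfl⟩

lemma IsBdd.ballInf_le {u : X → ℝ} (hu : IsBdd u) {δ : ℝ} {x y : X} (h : dist y x < δ) :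
    ballInf u δ x ≤ u y :=
  csInf_le (hu.bddBelow _) ⟨y, h, rfl⟩

lemma image_ball_nonempty (u : X → ℝ) {δ : ℝ} (hδ : 0 < δ) (x : X) : (u '' ball x δ).Nonempty :=
  ⟨u x, x, mem_ball_self hδ, rfl⟩

lemma ballSup_le {u : X → ℝ} {δ c : ℝ} (hδ : 0 < δ) {x : X}
    (h : ∀ y, dist y x < δ → u y ≤ c) : ballSup u δ x ≤ c :=
  csSup_le (image_ball_nonempty u hδ x) (by rintro _ ⟨y, hy, rfl⟩; exact h y hy)

lemma le_ballInf {u : X → ℝ} {δ c : ℝ} (hδ : 0 < δ) {x : X}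
    (h : ∀ y, dist y x < δ → c ≤ u y) : c ≤ ballInf u δ x :=
  le_csInf (image_ball_nonempty u hδ x) (by rintro _ ⟨y, hy, rfl⟩; exact h y hy)

lemma exists_lt_of_lt_ballSup {u : X → ℝ} {δ c : ℝ} (hδ : 0 < δ) {x : X}
    (h : c < ballSup u δ x) : ∃ y, dist y x < δ ∧ c < u y := by
  obtain ⟨_, ⟨y, hy, rfl⟩, hc⟩ := exists_lt_of_lt_csSup (image_ball_nonempty u hδ x) h
  exact ⟨y, hy, hc⟩

lemma exists_lt_of_ballInf_lt {u : X → ℝ} {δ c : ℝ} (hδ : 0 < δ) {x : X}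
    (h : ballInf u δ x < c) : ∃ y, dist y x < δ ∧ u y < c := by
  obtain ⟨_, ⟨y, hy, rfl⟩, hc⟩ := exists_lt_of_csInf_lt (image_ball_nonempty u hδ x) h
  exact ⟨y, hy, hc⟩

lemma ballSup_neg (u : X → ℝ) (δ : ℝ) (x : X) : ballSup (-u) δ x = -ballInf u δ x := by
  rw [ballSup, ballInf, image_neg_eq, Real.sInf_def, neg_neg]

lemma ballInf_neg (u : X → ℝ) (δ : ℝ) (x : X) : ballInf (-u) δ x = -ballSup u δ x := by
  rw [ballSup, ballInf, image_neg_eq, Real.sInf_def, neg_neg]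

lemma IsSuper.neg {ρ δ : ℝ} (hρ : 0 < ρ) {S : Set X} {u : X → ℝ} (h : IsSuper ρ δ S u) :
    IsSub ρ⁻¹ δ S (-u) := by
  intro x hx
  have := h x hx
  rw [ballSup_neg, ballInf_neg, Pi.neg_apply, ← mul_le_mul_iff_right₀ hρ]
  have e : ρ * ρ⁻¹ = 1 := mul_inv_cancel₀ hρ.ne'
  linear_combination this - (u x - ballInf u δ x) * e

lemma IsSub.neg {ρ δ : ℝ} (hρ : 0 < ρ) {S : Set X} {u : X → ℝ} (h : IsSub ρ δ S u) :
    IsSuper ρ⁻¹ δ S (-u) := by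
  intro x hx
  have := h x hx
  rw [ballSup_neg, ballInf_neg, Pi.neg_apply, ← mul_le_mul_iff_right₀ hρ]
  have e : ρ * ρ⁻¹ = 1 := mul_inv_cancel₀ hρ.ne'
  linear_combination this + (u x - ballInf u δ x) * e

lemma IsBdd.ballSup {u : X → ℝ} (hu : IsBdd u) {δ : ℝ} (hδ : 0 < δ) : IsBdd (ballSup u δ) := by
  obtain ⟨C, hC⟩ := hu
  refine ⟨C, fun x => abs_le.2 ⟨?_, ballSup_le hδ fun y _ => (abs_le.1 (hC y)).2⟩⟩
  exact (abs_le.1 (hC x)).1.trans (IsBdd.le_ballSup ⟨C, hC⟩ (by simpa using hδ))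

lemma ballSup_le_add {u v : X → ℝ} (hv : IsBdd v) {M δ : ℝ} (hδ : 0 < δ)
    (h : ∀ z, u z - v z ≤ M) (x : X) : ballSup u δ x ≤ ballSup v δ x + M :=
  ballSup_le hδ fun y hy => by linarith [h y, hv.le_ballSup hy]

lemma ballInf_le_add {u v : X → ℝ} (hu : IsBdd u) {M δ : ℝ} (hδ : 0 < δ)
    (h : ∀ z, u z - v z ≤ M) (x : X) : ballInf u δ x ≤ ballInf v δ x + M := by
  suffices ballInf u δ x - M ≤ ballInf v δ x by linarith
  exact le_ballInf hδ fun y hy => by linarith [h y, hu.ballInf_le hy]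

/-- In a length space, balls of radii `a` and `b` meet if their centres are closer than `a + b`. -/
lemma _root_.IsLengthSpace.exists_between (hX : IsLengthSpace X) {x y : X} {a b : ℝ} (ha : 0 < a)
    (hb : 0 < b) (h : dist x y < a + b) : ∃ z, dist x z < a ∧ dist z y < b := by
  have h1 : edist x y < ENNReal.ofReal (a + b) := by
    rw [edist_dist]
    exact (ENNReal.ofReal_lt_ofReal_iff (by positivity)).2 h
  rw [hX x y, iInf_lt_iff] at h1
  obtain ⟨γ, hγ⟩ := h1
  set ℓ := (eVariationOn (fun t => γ t) Set.univ).toReal with hℓ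
  have hfin : eVariationOn (fun t => γ t) Set.univ ≠ ⊤ := ne_top_of_lt hγ
  have hlt : ℓ < a + b := by
    rw [hℓ]
    exact (ENNReal.lt_ofReal_iff_toReal_lt hfin).1 hγ
  have hsum : ∀ t, dist x (γ t) + dist (γ t) y ≤ ℓ := by
    intro t
    have e1 : edist (γ 0) (γ t) ≤ eVariationOn (fun t => γ t) (Iic t) :=
      eVariationOn.edist_le _ (mem_Iic.2 t.2.1) (mem_Iic.2 le_rfl)
    have e2 : edist (γ t) (γ 1) ≤ eVariationOn (fun t => γ t) (Ici t) :=
      eVariationOn.edist_le _ (mem_Ici.2 le_rfl) (mem_Ici.2 t.2.2)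
    have e3 := eVariationOn.add_le_union (fun t => γ t) (s := Iic t) (t := Ici t)
      (fun p hp q hq => le_trans hp hq)
    have e4 := (add_le_add e1 e2).trans (e3.trans (eVariationOn.mono _ (subset_univ _)))
    rw [γ.source, γ.target, edist_dist, edist_dist,
      ← ENNReal.ofReal_add dist_nonneg dist_nonneg] at e4
    exact (ENNReal.ofReal_le_iff_le_toReal hfin).1 e4
  by_cases hxy : dist x y < a
  · exact ⟨y, hxy, by simpa using hb⟩
  push Not at hxy
  set c := max 0 ((ℓ - b + a) / 2) with hc
  have hca : c < a := max_lt ha (by linarith)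
  have hcb : ℓ - c < b := by
    have := le_max_right 0 ((ℓ - b + a) / 2)
    linarith
  have hcont : Continuous fun t => dist x (γ t) := by fun_prop
  obtain ⟨t, ht⟩ : c ∈ range fun t => dist x (γ t) := by
    refine mem_range_of_exists_le_of_exists_ge hcont ⟨0, ?_⟩ ⟨1, ?_⟩
    · simp [hc]
    · simpa using hca.le.trans hxy
  refine ⟨γ t, ht.trans_lt hca, ?_⟩
  have := hsum t
  simp only at ht
  linarith

/-- Where `u - v` is almost maximal, so is the difference of the infima over balls. -/
lemma almost_max {ρ δ : ℝ} (hρ : 1 ≤ ρ) (hδ : 0 < δ) {u v : X → ℝ} (hv : IsBdd v)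
    {S : Set X} (hsub : IsSub ρ δ S u) (hsup : IsSuper ρ δ S v) {M : ℝ}
    (hM : ∀ z, u z - v z ≤ M) {x : X} (hx : x ∈ S) {η : ℝ} (h : M - η < u x - v x) :
    ballInf v δ x + M - (1 + ρ) * η < ballInf u δ x := by
  have h1 := hsub x hx
  have h2 := hsup x hx
  have h3 := ballSup_le_add hv hδ hM x
  nlinarith

/-- Where `u - v` is almost maximal, the supersolution `v` has small downward slope. -/
lemma small_slope {ρ δ : ℝ} (hρ : 1 ≤ ρ) (hδ : 0 < δ) {u v : X → ℝ} (hu : IsBdd u) (hv : IsBdd v)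
    {S : Set X} (hsub : IsSub ρ δ S u) (hsup : IsSuper ρ δ S v) {M c : ℝ} (hc : c < M)
    (hM : ∀ z, u z - v z ≤ M) (hS : ∀ x ∉ S, u x ≤ v x + c) {σ : ℝ} (hσ : 0 < σ) :
    ∃ η > 0, ∀ x, M - η < u x - v x → v x - ballInf v δ x ≤ σ := by
  have hmem : ∀ {x η}, η ≤ M - c → M - η < u x - v x → x ∈ S := by
    intro x η h1 h2
    by_contra hx
    linarith [hS x hx]
  have hv' := hv
  obtain ⟨C, hC⟩ := hv'
  have key : ∀ N : ℕ, ∀ σ' > σ / 2, ∃ η > 0, ∀ x, M - η < u x - v x →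
      σ' < v x - ballInf v δ x → -C + N * (σ / 2) ≤ v x := by
    intro N
    induction N with
    | zero => exact fun σ' _ => ⟨1, one_pos, fun x _ _ => by simpa using (abs_le.1 (hC x)).1⟩
    | succ N ih =>
      intro σ' hσ'
      obtain ⟨η', hη', H⟩ := ih ((σ' + σ / 2) / 2) (by linarith)
      set η := min (min (η' / (2 + ρ)) ((σ' - σ / 2) / 2)) ((M - c) / (2 + ρ)) with hη
      have i1 : η ≤ η' / (2 + ρ) := (min_le_left _ _).trans (min_le_left _ _)
      have i2 : η ≤ (σ' - σ / 2) / 2 := (min_le_left _ _).trans (min_le_right _ _)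
      have i3 : η ≤ (M - c) / (2 + ρ) := min_le_right _ _
      have i0 : 0 < η := lt_min (lt_min (by positivity) (by linarith))
        (div_pos (by linarith) (by linarith))
      rw [le_div_iff₀ (by linarith)] at i1 i3
      refine ⟨η, i0, fun x hx hs => ?_⟩
      have hxS := hmem (η := η) (by nlinarith) hx
      have hinf := almost_max hρ hδ hv hsub hsup hM hxS hx
      obtain ⟨z, hzx, hz⟩ := exists_lt_of_ballInf_lt hδ (show ballInf v δ x < ballInf v δ x + η by
        linarith)
      have hz' : M - (2 + ρ) * η < u z - v z := by linarith [hu.ballInf_le hzx]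
      have hzS : z ∈ S := hmem (by linarith) hz'
      have hxz : v x ≤ ballSup v δ z := hv.le_ballSup (by rwa [dist_comm])
      have hzz : v z ≤ ballSup v δ z := hv.le_ballSup (by simpa using hδ)
      have h2 := hsup z hzS
      have hslope : v x - v z ≤ v z - ballInf v δ z := by nlinarith
      have := H z (by linarith) (by linarith)
      push_cast
      linarith
  obtain ⟨N, hN⟩ := exists_nat_gt ((2 * C) / (σ / 2))
  rw [div_lt_iff₀ (by positivity)] at hN
  obtain ⟨η, hη, H⟩ := key N σ (by linarith)
  refine ⟨η, hη, fun x hx => ?_⟩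
  by_contra! hcon
  linarith [H x hx hcon, (abs_le.1 (hC x)).2]

/-- The almost-maximal set of `u - v` spreads to whole balls. -/
lemma almost_max_spreads {ρ δ : ℝ} (hρ : 1 ≤ ρ) (hδ : 0 < δ) {u v : X → ℝ} (hu : IsBdd u)
    (hv : IsBdd v) {S : Set X} (hsub : IsSub ρ δ S u) (hsup : IsSuper ρ δ S v) {M c : ℝ}
    (hc : c < M) (hM : ∀ z, u z - v z ≤ M) (hS : ∀ x ∉ S, u x ≤ v x + c) {η : ℝ} (hη : 0 < η) :
    ∃ η' > 0, ∀ x, M - η' < u x - v x → ∀ z, dist z x < δ → M - η < u z - v z := by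
  obtain ⟨η₁, hη₁, H⟩ := small_slope hρ hδ hu hv hsub hsup hc hM hS (σ := η / 4) (by linarith)
  set η' := min (min η₁ (η / 2 / (1 + ρ))) (M - c)
  have i1 : η' ≤ η₁ := (min_le_left _ _).trans (min_le_left _ _)
  have i2 : η' ≤ η / 2 / (1 + ρ) := (min_le_left _ _).trans (min_le_right _ _)
  have i3 : η' ≤ M - c := min_le_right _ _
  have i0 : 0 < η' := lt_min (lt_min hη₁ (by positivity)) (by linarith)
  rw [le_div_iff₀ (by linarith)] at i2
  refine ⟨η', i0, fun x hx z hz => ?_⟩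
  have hxS : x ∈ S := by
    by_contra hxn
    linarith [hS x hxn]
  have hinf := almost_max hρ hδ hv hsub hsup hM hxS hx
  have hslope := H x (by linarith)
  have h2 := hsup x hxS
  have hxx : v x ≤ ballSup v δ x := hv.le_ballSup (by simpa using hδ)
  have : ballSup v δ x - v x ≤ v x - ballInf v δ x := by nlinarith
  linarith [hu.ballInf_le hz, hv.le_ballSup hz]

lemma exists_nat_dist_lt [CompactSpace X] {δ : ℝ} (hδ : 0 < δ) :
    ∃ N : ℕ, ∀ x y : X, dist x y < (N + 1) * δ := by
  obtain ⟨N, hN⟩ := exists_nat_gt (diam (univ : Set X) / δ)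
  rw [div_lt_iff₀ hδ] at hN
  refine ⟨N, fun x y => ?_⟩
  have := dist_le_diam_of_mem (isCompact_univ (X := X)).isBounded (mem_univ x) (mem_univ y)
  linarith

lemma comparison_of_one_le [CompactSpace X] (hX : IsLengthSpace X) {ρ δ : ℝ} (hρ : 1 ≤ ρ)
    (hδ : 0 < δ) {u v : X → ℝ} (hu : IsBdd u) (hv : IsBdd v) {S : Set X} (hsub : IsSub ρ δ S u)
    (hsup : IsSuper ρ δ S v) {c : ℝ} (hS : ∀ x ∉ S, u x ≤ v x + c) (hne : Sᶜ.Nonempty) (x : X) :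
    u x ≤ v x + c := by
  by_contra! hx
  have hbdd : BddAbove (range fun x => u x - v x) := by
    simpa using (hu.sub hv).bddAbove univ
  set M := ⨆ x, (u x - v x) with hMdef
  have hM : ∀ z, u z - v z ≤ M := le_ciSup hbdd
  have hc : c < M := by linarith [hM x]
  have spread : ∀ N : ℕ, ∀ η > 0, ∃ η' > 0, ∀ x, M - η' < u x - v x →
      ∀ z, dist z x < (N + 1) * δ → M - η < u z - v z := by
    intro N
    induction N with
    | zero =>
      intro η hη
      simpa using almost_max_spreads hρ hδ hu hv hsub hsup hc hM hS hη
    | succ N ih =>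
      intro η hη
      obtain ⟨η₁, hη₁, H₁⟩ := almost_max_spreads hρ hδ hu hv hsub hsup hc hM hS hη
      obtain ⟨η₂, hη₂, H₂⟩ := ih η₁ hη₁
      refine ⟨η₂, hη₂, fun x hx z hz => ?_⟩
      obtain ⟨y, hy1, hy2⟩ := hX.exists_between (x := z) (y := x) hδ
        (b := (N + 1) * δ) (by positivity) (by push_cast at hz; linarith)
      exact H₁ y (H₂ x hx y hy2) z hy1
  obtain ⟨N, hN⟩ := exists_nat_dist_lt (X := X) hδ
  obtain ⟨η, hη, H⟩ := spread N (M - c) (by linarith)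
  have : Nonempty X := ⟨x⟩
  obtain ⟨x₁, hx₁⟩ := exists_lt_of_lt_ciSup (show M - η < ⨆ x, (u x - v x) by linarith)
  obtain ⟨y, hy⟩ := hne
  linarith [H x₁ hx₁ y (hN _ _), hS y hy]

/-- Comparison principle for the game with step `δ` and odds `ρ`. -/
lemma comparison [CompactSpace X] (hX : IsLengthSpace X) {ρ δ : ℝ} (hρ : 0 < ρ)
    (hδ : 0 < δ) {u v : X → ℝ} (hu : IsBdd u) (hv : IsBdd v) {S : Set X} (hsub : IsSub ρ δ S u)
    (hsup : IsSuper ρ δ S v) {c : ℝ} (hS : ∀ x ∉ S, u x ≤ v x + c) (hne : Sᶜ.Nonempty) (x : X) :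
    u x ≤ v x + c := by
  rcases le_total 1 ρ with h | h
  · exact comparison_of_one_le hX h hδ hu hv hsub hsup hS hne x
  · have := comparison_of_one_le hX (one_le_inv_iff₀.2 ⟨hρ, h⟩) hδ hv.neg hu.neg (hsup.neg hρ)
      (hsub.neg hρ) (c := c) (fun x hx => by simpa using by linarith [hS x hx]) hne x
    simp only [Pi.neg_apply] at this
    linarith

open Classical in
/-- The barrier around `x₀`, an exponential cone in `d(x₀, x) + δ` with vertex value `b`. -/
def barrier (x₀ : X) (b A lam δ : ℝ) (x : X) : ℝ :=
  if x = x₀ then b else b + A * (1 - Real.exp (-(lam * (dist x x₀ + δ))))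

lemma barrier_le {x₀ : X} {b A lam δ : ℝ} (hA : 0 ≤ A) (hlam : 0 ≤ lam) (hδ : 0 ≤ δ) {x : X}
    {r : ℝ} (hr : dist x x₀ + δ ≤ r) :
    barrier x₀ b A lam δ x ≤ b + A * (1 - Real.exp (-(lam * r))) := by
  have hd : 0 ≤ dist x x₀ := dist_nonneg
  unfold barrier
  split_ifs with h
  · have : Real.exp (-(lam * r)) ≤ 1 := Real.exp_le_one_iff.2 (by nlinarith)
    nlinarith
  · gcongr

lemma le_barrier {x₀ : X} {b A lam δ : ℝ} (hA : 0 ≤ A) (hlam : 0 ≤ lam) (hδ : 0 ≤ δ) (x : X) :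
    b ≤ barrier x₀ b A lam δ x := by
  have hd : 0 ≤ dist x x₀ := dist_nonneg
  unfold barrier
  split_ifs with h
  · exact le_rfl
  · have : Real.exp (-(lam * (dist x x₀ + δ))) ≤ 1 := Real.exp_le_one_iff.2
      (by nlinarith [mul_nonneg hlam (add_nonneg hd hδ)])
    nlinarith

lemma isBdd_barrier {x₀ : X} {b A lam δ : ℝ} (hA : 0 ≤ A) (hlam : 0 ≤ lam) (hδ : 0 ≤ δ) :
    IsBdd (barrier x₀ b A lam δ) := by
  refine ⟨|b| + A, fun x => abs_le.2 ⟨?_, ?_⟩⟩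
  · linarith [neg_abs_le b, le_barrier (b := b) (x₀ := x₀) hA hlam hδ x]
  · have h1 := barrier_le (b := b) (x₀ := x₀) hA hlam hδ (x := x) le_rfl
    have h2 := mul_nonneg hA (Real.exp_pos (-(lam * (dist x x₀ + δ)))).le
    linarith [le_abs_self b]

/-- Away from its vertex, the barrier is a strict supersolution. -/
lemma barrier_strict_super (hX : IsLengthSpace X) {x₀ : X} {b A lam δ ρ : ℝ} (hA : 0 ≤ A)
    (hlam : 0 ≤ lam) (hδ : 0 < δ) (hρ : 0 ≤ ρ) {x : X} (hx : x ≠ x₀) :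
    ρ * ballSup (barrier x₀ b A lam δ) δ x + ballInf (barrier x₀ b A lam δ) δ x +
      A * Real.exp (-(lam * (dist x x₀ + δ))) * ((Real.exp (lam * δ) - 1) *
        (1 - ρ * Real.exp (-(lam * δ)))) ≤ (1 + ρ) * barrier x₀ b A lam δ x := by
  set v := barrier x₀ b A lam δ with hv
  have hbdd : IsBdd v := isBdd_barrier hA hlam hδ.le
  set d := dist x x₀ with hd
  have hd0 : 0 ≤ d := dist_nonneg
  have hvx : v x = b + A * (1 - Real.exp (-(lam * (d + δ)))) := by simp [hv, barrier, hx, hd]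
  have hs : ballSup v δ x ≤ b + A * (1 - Real.exp (-(lam * (d + 2 * δ)))) := by
    refine ballSup_le hδ fun y hy => barrier_le hA hlam hδ.le ?_
    linarith [dist_triangle y x x₀]
  have hi : ballInf v δ x ≤ b + A * (1 - Real.exp (-(lam * d))) := by
    rcases lt_or_ge d δ with h | h
    · have h1 : ballInf v δ x ≤ v x₀ := hbdd.ballInf_le (by rwa [dist_comm])
      have h2 : v x₀ = b := by simp [hv, barrier]
      have : Real.exp (-(lam * d)) ≤ 1 := Real.exp_le_one_iff.2
        (by nlinarith [mul_nonneg hlam hd0])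
      nlinarith
    · have hη : ∀ η > 0, ballInf v δ x ≤ b + A * (1 - Real.exp (-(lam * (d + η)))) := by
        intro η hη
        obtain ⟨z, hz1, hz2⟩ := hX.exists_between (x := x) (y := x₀) hδ (b := d - δ + η)
          (by linarith) (by linarith)
        exact (hbdd.ballInf_le (by rwa [dist_comm])).trans
          (barrier_le hA hlam hδ.le (by linarith))
      have ht : Tendsto (fun η : ℝ => b + A * (1 - Real.exp (-(lam * (d + η)))))
          (nhdsWithin 0 (Ioi 0)) (nhds (b + A * (1 - Real.exp (-(lam * (d + 0)))))) :=
        Tendsto.mono_left (Continuous.tendsto (by fun_prop) 0) nhdsWithin_le_nhds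
      rw [add_zero] at ht
      exact ge_of_tendsto ht (eventually_nhdsWithin_of_forall hη)
  set E := Real.exp (-(lam * (d + δ))) with hE
  set q := Real.exp (lam * δ) with hq
  set r := Real.exp (-(lam * δ)) with hr
  have hqr : q * r = 1 := by rw [hq, hr, ← Real.exp_add]; simp
  have e1 : Real.exp (-(lam * (d + 2 * δ))) = E * r := by rw [hE, hr, ← Real.exp_add]; ring_nf
  have e2 : Real.exp (-(lam * d)) = E * q := by rw [hE, hq, ← Real.exp_add]; ring_nf
  rw [e1] at hs
  rw [e2] at hi
  rw [hvx]
  linear_combination ρ * hs + hi - A * E * ρ * hqr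

/-- A subsolution lying below a cone on `Y` with vertex `x₀` lies below a steeper cone. -/
lemma le_cone (hX : IsLengthSpace X) {ρ δ lam R K : ℝ} (hδ : 0 < δ) (hδ1 : δ ≤ 1) (hlam : 0 < lam)
    (hρ : 0 < ρ) (hρl : ρ < Real.exp (lam * δ)) (hR : ∀ x y : X, dist x y ≤ R) (hK : 0 < K)
    {u : X → ℝ} (hu : IsBdd u) {Y : Set X} (hsub : IsSub ρ δ Yᶜ u) {x₀ : X}
    (hY : ∀ y ∈ Y, u y ≤ u x₀ + K * (dist y x₀ + δ)) (x : X) :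
    u x ≤ u x₀ + K * Real.exp (lam * (R + 1)) * (dist x x₀ + δ) := by
  set A := K * Real.exp (lam * (R + 1)) / lam with hA
  have hA0 : 0 < A := by positivity
  have hAl : A * lam = K * Real.exp (lam * (R + 1)) := by rw [hA]; field_simp
  set v := barrier x₀ (u x₀) A lam δ with hv
  have hbdd : IsBdd v := isBdd_barrier hA0.le hlam.le hδ.le
  suffices h : u x ≤ v x by
    have h1 := barrier_le (b := u x₀) (x₀ := x₀) hA0.le hlam.le hδ.le (x := x) le_rfl
    have h2 := Real.add_one_le_exp (-(lam * (dist x x₀ + δ)))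
    have h3 := mul_le_mul_of_nonneg_left h2 hA0.le
    rw [← hAl]
    linarith
  have hYv : ∀ y ∈ Y, u y ≤ v y := by
    intro y hy
    by_cases hyx : y = x₀
    · simp [hv, barrier, hyx]
    refine (hY y hy).trans ?_
    have e : v y = u x₀ + A * (1 - Real.exp (-(lam * (dist y x₀ + δ)))) := by
      simp [hv, barrier, hyx]
    rw [e]
    set s := dist y x₀ + δ
    have hs0 : 0 ≤ s := add_nonneg dist_nonneg hδ.le
    have hsR : s ≤ R + 1 := add_le_add (hR _ _) hδ1
    have h1 : Real.exp (-(lam * s)) * (lam * s) ≤ 1 - Real.exp (-(lam * s)) := by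
      have h2 := mul_le_mul_of_nonneg_left (Real.add_one_le_exp (lam * s))
        (Real.exp_pos (-(lam * s))).le
      rw [← Real.exp_add, neg_add_cancel, Real.exp_zero] at h2
      linarith
    have h3 : 1 ≤ Real.exp (lam * (R + 1)) * Real.exp (-(lam * s)) := by
      rw [← Real.exp_add]
      exact Real.one_le_exp (by nlinarith)
    have h4 := mul_le_mul_of_nonneg_left h1 hA0.le
    have h5 := mul_le_mul_of_nonneg_left h3 (mul_nonneg hK.le hs0)
    have h6 : A * (Real.exp (-(lam * s)) * (lam * s)) =
        K * s * (Real.exp (lam * (R + 1)) * Real.exp (-(lam * s))) := by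
      linear_combination Real.exp (-(lam * s)) * s * hAl
    linarith
  by_contra! hx
  have hab : BddAbove (range fun x => u x - v x) := by
    simpa using (hu.sub hbdd).bddAbove univ
  have hM : ∀ z, u z - v z ≤ ⨆ x, (u x - v x) := le_ciSup hab
  set M := ⨆ x, (u x - v x) with hMdef
  have hM0 : 0 < M := by linarith [hM x]
  set c := A * Real.exp (-(lam * (R + δ))) * ((Real.exp (lam * δ) - 1) *
        (1 - ρ * Real.exp (-(lam * δ)))) with hc
  have hq1 : 0 < Real.exp (lam * δ) - 1 := by
    have := Real.one_lt_exp_iff.2 (mul_pos hlam hδ)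
    linarith
  have hq2 : 0 < 1 - ρ * Real.exp (-(lam * δ)) := by
    have := mul_lt_mul_of_pos_right hρl (Real.exp_pos (-(lam * δ)))
    rw [← Real.exp_add, add_neg_cancel, Real.exp_zero] at this
    linarith
  have hc0 : 0 < c := by positivity
  have hηpos : 0 < min M (c / (1 + ρ)) := by positivity
  have : Nonempty X := ⟨x⟩
  obtain ⟨z, hz⟩ := exists_lt_of_lt_ciSup
    (show M - min M (c / (1 + ρ)) < ⨆ x, (u x - v x) by linarith)
  have hz1 : 0 < u z - v z := by linarith [min_le_left M (c / (1 + ρ))]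
  have hz2 : M - c / (1 + ρ) < u z - v z := by linarith [min_le_right M (c / (1 + ρ))]
  have hzx : z ≠ x₀ := by
    rintro rfl
    simp [hv, barrier] at hz1
  have hzY : z ∈ Yᶜ := fun h => by linarith [hYv z h]
  have h1 := hsub z hzY
  have h2 := barrier_strict_super (b := u x₀) hX hA0.le hlam.le hδ hρ.le hzx
  have h3 : c ≤ A * Real.exp (-(lam * (dist z x₀ + δ))) * ((Real.exp (lam * δ) - 1) *
        (1 - ρ * Real.exp (-(lam * δ)))) := by
    have := hR z x₀
    rw [hc]
    gcongr
  have h4 := ballSup_le_add hbdd hδ hM z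
  have h5 := ballInf_le_add hu hδ hM z
  have h6 := mul_lt_mul_of_pos_left hz2 (show 0 < 1 + ρ by linarith)
  rw [mul_sub, mul_div_cancel₀ _ (by linarith)] at h6
  have h7 := mul_le_mul_of_nonneg_left h4 hρ.le
  linarith

/-- Taking suprema over `δ`-balls turns a `δ`-subsolution into a `2δ`-subsolution. -/
lemma ballSup_isSub (hX : IsLengthSpace X) {ρ δ : ℝ} (hρ : 0 < ρ) (hδ : 0 < δ) {u : X → ℝ}
    (hu : IsBdd u) {S T : Set X} (hsub : IsSub ρ δ S u)
    (hT : ∀ x ∈ T, ∀ z, dist z x < 2 * δ → z ∈ S) :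
    IsSub (ρ ^ 2) (2 * δ) T (ballSup u δ) := by
  intro x hx
  have hw := hu.ballSup hδ
  have hxS := hsub x (hT x hx x (by simpa using hδ))
  have hinf : ballInf u δ x ≤ ballInf (ballSup u δ) (2 * δ) x := by
    refine le_ballInf (by linarith) fun y hy => ?_
    obtain ⟨z, hz1, hz2⟩ := hX.exists_between hδ hδ (show dist x y < δ + δ by
      rw [dist_comm]; linarith)
    exact (hu.ballInf_le (by rwa [dist_comm])).trans (hu.le_ballSup hz2)
  refine le_of_forall_pos_le_add fun η' hη' => ?_
  obtain ⟨η, hη, hηη'⟩ : ∃ η > 0, (2 * ρ ^ 2 + 2 * ρ + 1) * η = η' :=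
    ⟨η' / (2 * ρ ^ 2 + 2 * ρ + 1), by positivity, by field_simp⟩
  obtain ⟨z₁, hz₁, h₁⟩ := exists_lt_of_lt_ballSup hδ (show ballSup u δ x - η < ballSup u δ x by
    linarith)
  obtain ⟨z₂, hz₂, h₂⟩ := exists_lt_of_lt_ballSup hδ
    (show ballSup u δ z₁ - η < ballSup u δ z₁ by linarith)
  have hz₂x : dist z₂ x < 2 * δ := by linarith [dist_triangle z₂ z₁ x]
  have s₁ := hsub z₁ (hT x hx z₁ (by linarith))
  have s₂ := hsub z₂ (hT x hx z₂ hz₂x)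
  have i₁ : ballInf u δ z₁ ≤ u x := hu.ballInf_le (by rwa [dist_comm])
  have i₂ : ballInf u δ z₂ ≤ u z₁ := hu.ballInf_le (by rwa [dist_comm])
  have hsup : ballSup u δ z₂ ≤ ballSup (ballSup u δ) (2 * δ) x := hw.le_ballSup hz₂x
  have a1 := mul_le_mul_of_nonneg_left hsup (sq_nonneg ρ)
  have a2 := mul_le_mul_of_nonneg_left (s₂.trans (add_le_add_right i₂ _)) hρ.le
  have a3 := mul_le_mul_of_nonneg_left h₂.le (show 0 ≤ ρ ^ 2 + ρ by positivity)
  have a4 := mul_le_mul_of_nonneg_left (s₁.trans (add_le_add_right i₁ _))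
    (show 0 ≤ ρ + 1 by positivity)
  have a5 := mul_le_mul_of_nonneg_left h₁.le (show 0 ≤ ρ ^ 2 + ρ + 1 by positivity)
  linarith

/-- One-sided comparison of the games with steps `δ` and `2δ`. -/
lemma le_of_double_step [CompactSpace X] (hX : IsLengthSpace X) {ρ₁ ρ₂ δ L : ℝ} (hρ₁ : 0 < ρ₁)
    (hρ : ρ₁ ^ 2 ≤ ρ₂) (hδ : 0 < δ) {u v : X → ℝ} (hu : IsBdd u) (hv : IsBdd v) {Y : Set X}
    (hne : Y.Nonempty) (hsub : IsSub ρ₁ δ Yᶜ u) (hsup : IsSuper ρ₂ (2 * δ) Yᶜ v) (hL : 0 ≤ L)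
    (huL : ∀ x, ∀ y ∈ Y, u x ≤ u y + L * (dist x y + δ))
    (hvL : ∀ x, ∀ y ∈ Y, v y ≤ v x + L * (dist x y + 2 * δ))
    (huv : ∀ y ∈ Y, u y = v y) (x : X) : u x ≤ v x + 8 * L * δ := by
  set T : Set X := {x | ∀ y ∈ Y, 2 * δ ≤ dist y x} with hT
  have hwsub : IsSub (ρ₁ ^ 2) (2 * δ) T (ballSup u δ) := by
    refine ballSup_isSub hX hρ₁ hδ hu hsub fun x hx z hz hzY => ?_
    linarith [hx z hzY]
  have hwsub' : IsSub ρ₂ (2 * δ) T (ballSup u δ) := by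
    intro x hx
    have h1 := hwsub x hx
    have h2 : ballSup u δ x ≤ ballSup (ballSup u δ) (2 * δ) x :=
      (hu.ballSup hδ).le_ballSup (by simpa using hδ)
    nlinarith
  have hTY : T ⊆ Yᶜ := fun x hx hxY => by
    have := hx x hxY
    rw [dist_self] at this
    linarith
  refine (hu.le_ballSup (show dist x x < δ by simpa using hδ)).trans ?_
  refine comparison hX (lt_of_lt_of_le (by positivity) hρ) (by linarith) (hu.ballSup hδ) hv hwsub'
    (fun z hz => hsup z (hTY hz)) ?_ ?_ x
  · intro z hz
    simp only [hT, mem_ofPred_eq, not_forall, not_le] at hz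
    obtain ⟨y, hy, hyz⟩ := hz
    refine ballSup_le hδ fun z' hz' => ?_
    have h1 := huL z' y hy
    have h2 := hvL z y hy
    rw [dist_comm] at hyz
    have h3 : L * (dist z' y + δ) ≤ L * (4 * δ) :=
      mul_le_mul_of_nonneg_left (by linarith [dist_triangle z' z y]) hL
    have h4 : L * (dist z y + 2 * δ) ≤ L * (4 * δ) :=
      mul_le_mul_of_nonneg_left (by linarith) hL
    linarith [huv y hy]
  · obtain ⟨y, hy⟩ := hne
    exact ⟨y, fun h => hTY h hy⟩

lemma exists_tendsto_of_le_add {f : ℕ → ℝ} {B c : ℝ} (hB : ∀ n, |f n| ≤ B) (hc : 0 ≤ c)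
    (h : ∀ n, f (n + 1) ≤ f n + c / 2 ^ (n + 1)) : ∃ l, Tendsto f atTop (nhds l) := by
  have hanti : Antitone fun n => f n + c / 2 ^ n := by
    refine antitone_nat_of_succ_le fun n => ?_
    have e : c / 2 ^ n = c / 2 ^ (n + 1) + c / 2 ^ (n + 1) := by rw [pow_succ]; field_simp; norm_num
    linarith [h n]
  have hb : BddBelow (range fun n => f n + c / 2 ^ n) := by
    refine ⟨-B, ?_⟩
    rintro _ ⟨n, rfl⟩
    have : 0 ≤ c / 2 ^ n := by positivity
    simp only
    linarith [(abs_le.1 (hB n)).1]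
  have h0 : Tendsto (fun n : ℕ => c / 2 ^ n) atTop (nhds 0) := by
    have := (tendsto_pow_atTop_nhds_zero_of_lt_one (r := (1 / 2 : ℝ)) (by norm_num)
      (by norm_num)).const_mul c
    simpa [div_eq_mul_inv] using this
  refine ⟨_, ((tendsto_atTop_ciInf hanti hb).sub h0).congr fun n => ?_⟩
  simp

/-- Pointwise convergence of asymptotically equi-Lipschitz functions on a compact space is
uniform. -/
lemma tendstoUniformly_of_almost_lipschitz [CompactSpace X] {u : ℕ → X → ℝ} {v : X → ℝ} {L : ℝ}
    {e : ℕ → ℝ} (he : Tendsto e atTop (nhds 0)) (hL : 0 < L)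
    (hu : ∀ n x y, u n x ≤ u n y + L * (dist x y + e n))
    (hv : ∀ x, Tendsto (fun n => u n x) atTop (nhds (v x))) : TendstoUniformly u v atTop := by
  have hvL : ∀ x y, v x ≤ v y + L * dist x y := by
    intro x y
    have h1 : Tendsto (fun n => u n y + L * (dist x y + e n)) atTop
        (nhds (v y + L * (dist x y + 0))) := (hv y).add ((he.const_add _).const_mul L)
    rw [add_zero] at h1
    exact le_of_tendsto_of_tendsto' (hv x) h1 fun n => hu n x y
  rw [Metric.tendstoUniformly_iff]
  intro κ hκ
  set η := κ / (4 * L) with hη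
  have hη0 : 0 < η := by positivity
  have hLη : L * η = κ / 4 := by rw [hη]; field_simp
  obtain ⟨t, -, htf, ht⟩ := finite_cover_balls_of_compact (isCompact_univ (X := X)) hη0
  have h1 : ∀ᶠ n in atTop, ∀ x ∈ t, dist (u n x) (v x) < κ / 4 := by
    rw [eventually_all_finite htf]
    exact fun x _ => (Metric.tendsto_nhds.1 (hv x)) _ (by linarith)
  have h2 : ∀ᶠ n in atTop, e n < η := he.eventually_lt_const hη0
  filter_upwards [h1, h2] with n hn1 hn2 x
  obtain ⟨z, hz, hxz⟩ := mem_iUnion₂.1 (ht (mem_univ x))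
  have hxz : dist x z < η := hxz
  have g1 := hn1 z hz
  rw [Real.dist_eq, abs_lt] at g1 ⊢
  have g2 := hu n x z
  have g3 := hu n z x
  have g4 := hvL x z
  have g5 := hvL z x
  rw [dist_comm z x] at g3 g5
  have g6 : L * dist x z < κ / 4 := hLη ▸ mul_lt_mul_of_pos_left hxz hL
  have g7 : L * e n < κ / 4 := hLη ▸ mul_lt_mul_of_pos_left hn2 hL
  constructor <;> linarith

/-- Lipschitz bound at scales above `δ` for solutions with Lipschitz boundary values. -/
lemma almost_lipschitz (hX : IsLengthSpace X) {ρ δ lam R K : ℝ} (hδ : 0 < δ) (hδ1 : δ ≤ 1)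
    (hlam : 0 < lam) (hρ : 1 < ρ) (hρl : ρ < Real.exp (lam * δ)) (hR : ∀ x y : X, dist x y ≤ R)
    (hK : 0 < K) {u : X → ℝ} (hu : IsBdd u) {Y : Set X} (hsub : IsSub ρ δ Yᶜ u)
    (hsup : IsSuper ρ δ Yᶜ u) (hY : ∀ y ∈ Y, ∀ z ∈ Y, u y ≤ u z + K * dist y z) (x z : X) :
    u x ≤ u z + K * Real.exp (lam * (R + 1)) * Real.exp (lam * (R + 1)) * (dist x z + δ) := by
  have hρ0 : 0 < ρ := by linarith
  refine le_cone hX hδ hδ1 hlam hρ0 hρl hR (by positivity) hu hsub (x₀ := z) (fun y hy => ?_) x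
  have h := le_cone hX hδ hδ1 hlam (inv_pos.2 hρ0)
    ((inv_lt_one_of_one_lt₀ hρ).trans (Real.one_lt_exp_iff.2 (mul_pos hlam hδ))) hR hK hu.neg
    (hsup.neg hρ0) (x₀ := y) (fun y' hy' => ?_) z
  · rw [dist_comm y z]
    simp only [Pi.neg_apply] at h
    linarith
  · have := hY y hy y' hy'
    have h2 := mul_pos hK hδ
    rw [dist_comm y y'] at this
    simp only [Pi.neg_apply]
    linarith

/-- An odds function is squeezed between `1` and `exp (2βδ)` for small `δ > 0`. -/
lemma odds_bounds {β : ℝ} (hβ : 0 < β) {ρ : ℝ → ℝ} (h0 : ρ 0 = 1) (hd : deriv ρ 0 = β) :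
    ∃ r > 0, ∀ δ, 0 < δ → δ < r → 1 < ρ δ ∧ ρ δ < Real.exp (2 * β * δ) := by
  have hdiff : DifferentiableAt ℝ ρ 0 := differentiableAt_of_deriv_ne_zero (by rw [hd]; exact hβ.ne')
  have h := hdiff.hasDerivAt
  rw [hd, hasDerivAt_iff_isLittleO] at h
  have h1 := h.def (show 0 < β / 2 by linarith)
  obtain ⟨r, hr, H⟩ := Metric.eventually_nhds_iff.1 h1
  refine ⟨r, hr, fun δ hδ hδr => ?_⟩
  have h2 := H (show dist δ 0 < r by simpa [abs_of_pos hδ] using hδr)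
  simp only [h0, sub_zero, smul_eq_mul, Real.norm_eq_abs, abs_of_pos hδ, abs_le] at h2
  have h3 := mul_pos hβ hδ
  have h4 := Real.add_one_le_exp (2 * β * δ)
  constructor <;> linarith [h2.1, h2.2]

lemma isSub_and_isSuper_of_harmonic {ρ δ : ℝ} (hρ : 0 < ρ) {S : Set X} {u : X → ℝ}
    (h : InfinityHarmonicOn ((ρ - 1) / (ρ + 1)) δ S u) : IsSub ρ δ S u ∧ IsSuper ρ δ S u := by
  have key : ∀ x ∈ S, (1 + ρ) * u x = ρ * ballSup u δ x + ballInf u δ x := by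
    intro x hx
    rw [(h x hx).2.2, ballSup, ballInf]
    field_simp
    ring
  exact ⟨fun x hx => (key x hx).le, fun x hx => (key x hx).ge⟩

/-- A log-convex or log-concave function with value `1` at the origin is super- or
submultiplicative under doubling. -/
lemma sq_le_or_le_sq {ρ : ℝ → ℝ} {a : ℝ} (ha : 0 < a) (hpos : ∀ x ∈ Ioo (-a) a, 0 < ρ x)
    (h0 : ρ 0 = 1) (h : ConvexOn ℝ (Ioo (-a) a) (fun x => Real.log (ρ x)) ∨
     ConcaveOn ℝ (Ioo (-a) a) (fun x => Real.log (ρ x))) :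
    (∀ δ, 0 < δ → 2 * δ < a → ρ δ ^ 2 ≤ ρ (2 * δ)) ∨
      (∀ δ, 0 < δ → 2 * δ < a → ρ (2 * δ) ≤ ρ δ ^ 2) := by
  have m0 : (0 : ℝ) ∈ Ioo (-a) a := ⟨by linarith, ha⟩
  refine h.imp (fun h δ hδ hδa => ?_) (fun h δ hδ hδa => ?_) <;>
  · have m1 : δ ∈ Ioo (-a) a := ⟨by linarith, by linarith⟩
    have m2 : 2 * δ ∈ Ioo (-a) a := ⟨by linarith, by linarith⟩
    have := h.2 m0 m2 (show (0 : ℝ) ≤ 1 / 2 by norm_num) (show (0 : ℝ) ≤ 1 / 2 by norm_num)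
      (by norm_num)
    have e : (1 / 2 : ℝ) • (0 : ℝ) + (1 / 2 : ℝ) • (2 * δ) = δ := by simp
    simp only [e] at this
    simp only [h0, Real.log_one, smul_eq_mul] at this
    have p1 := hpos _ m1
    rw [← Real.log_le_log_iff (by first | exact hpos _ m2 | positivity)
      (by first | exact hpos _ m2 | positivity), Real.log_pow]
    push_cast
    linarith

end DyadicConvergence

end

open DyadicConvergence

/-- Dyadic convergence: if `ρ` satisfies condition (⋆) for `β > 0` with bias
`θ(ε) = (ρ(ε)−1)/(ρ(ε)+1)`, then for every sufficiently small `ε > 0` the sequence of unique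
bounded `(θ(ε/2ⁿ), ε/2ⁿ)`-infinity harmonic extensions of `F` converges uniformly on `X`. -/
theorem dyadic_uniform_convergence
    {X : Type*} [MetricSpace X] [CompactSpace X] (hX : IsLengthSpace X)
    (Y : Set X) (hYne : Y.Nonempty) (hYcl : IsClosed Y)
    (F : Y → ℝ) (K : NNReal) (hF : LipschitzWith K F)
    (β : ℝ) (hβ : 0 < β) (ρ : ℝ → ℝ) (hρ : OddsCondition β ρ) :
    ∃ ε₀ : ℝ, 0 < ε₀ ∧ ∀ ε : ℝ, 0 < ε → ε < ε₀ →
      ∀ u : ℕ → X → ℝ,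
        (∀ n : ℕ, (∃ C : ℝ, ∀ x, |u n x| ≤ C) ∧ (∀ y : Y, u n y = F y) ∧
          InfinityHarmonicOn ((ρ (ε / 2 ^ n) - 1) / (ρ (ε / 2 ^ n) + 1)) (ε / 2 ^ n) Yᶜ (u n)) →
        ∃ v : X → ℝ, TendstoUniformly u v Filter.atTop := by
  obtain ⟨a, ha, -, hpos, h0, hd, hlog⟩ := hρ
  obtain ⟨r, hr, hbd⟩ := odds_bounds hβ h0 hd
  refine ⟨min (min r a) 1, by positivity, fun ε hε hεlt u hu => ?_⟩
  rw [lt_min_iff, lt_min_iff] at hεlt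
  obtain ⟨⟨hεr, hεa⟩, hε1⟩ := hεlt
  set δ : ℕ → ℝ := fun n => ε / 2 ^ n with hδdef
  have hδ : ∀ n, 0 < δ n := fun n => by positivity
  have hδε : ∀ n, δ n ≤ ε := fun n => div_le_self hε.le (one_le_pow₀ (by norm_num))
  have hδ2 : ∀ n, 2 * δ (n + 1) = δ n := fun n => by
    simp only [hδdef, pow_succ]
    field_simp
  have hρ1 : ∀ n, 1 < ρ (δ n) := fun n => (hbd _ (hδ n) ((hδε n).trans_lt hεr)).1
  have hρ2 : ∀ n, ρ (δ n) < Real.exp (2 * β * δ n) := fun n =>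
    (hbd _ (hδ n) ((hδε n).trans_lt hεr)).2
  have hρ0 : ∀ n, 0 < ρ (δ n) := fun n => zero_lt_one.trans (hρ1 n)
  have hb : ∀ n, IsBdd (u n) := fun n => (hu n).1
  have huF : ∀ n (y : Y), u n y = F y := fun n => (hu n).2.1
  have hh : ∀ n, IsSub (ρ (δ n)) (δ n) Yᶜ (u n) ∧ IsSuper (ρ (δ n)) (δ n) Yᶜ (u n) := fun n =>
    isSub_and_isSuper_of_harmonic (hρ0 n) (hu n).2.2
  obtain ⟨R, hR⟩ : ∃ R, ∀ x y : X, dist x y ≤ R := ⟨diam (univ : Set X), fun x y =>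
    dist_le_diam_of_mem (isCompact_univ (X := X)).isBounded (mem_univ x) (mem_univ y)⟩
  obtain ⟨L, hL, hLip⟩ : ∃ L > 0, ∀ n x z, u n x ≤ u n z + L * (dist x z + δ n) := by
    have hK : (0 : ℝ) < K + 1 := by positivity
    refine ⟨(K + 1) * Real.exp (2 * β * (R + 1)) * Real.exp (2 * β * (R + 1)), by positivity,
      fun n x z => almost_lipschitz hX (hδ n) ((hδε n).trans hε1.le) (by positivity) (hρ1 n)
      (hρ2 n) hR hK (hb n) (hh n).1 (hh n).2 (fun y hy z hz => ?_) x z⟩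
    have h1 := (le_abs_self _).trans (hF.dist_le_mul ⟨y, hy⟩ ⟨z, hz⟩)
    rw [Subtype.dist_eq] at h1
    have h2 := huF n ⟨y, hy⟩
    have h3 := huF n ⟨z, hz⟩
    simp only at h1 h2 h3
    linarith [dist_nonneg (x := y) (y := z)]
  obtain ⟨y₀, hy₀⟩ := hYne
  have hbound : ∀ x n, |u n x| ≤ |F ⟨y₀, hy₀⟩| + L * (R + 1) := by
    intro x n
    have h1 := hLip n x y₀
    have h2 := hLip n y₀ x
    rw [dist_comm y₀ x] at h2
    have h3 : L * (dist x y₀ + δ n) ≤ L * (R + 1) :=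
      mul_le_mul_of_nonneg_left (add_le_add (hR _ _) ((hδε n).trans hε1.le)) hL.le
    have h4 : u n y₀ = F ⟨y₀, hy₀⟩ := huF n ⟨y₀, hy₀⟩
    rw [abs_le]
    constructor <;> linarith [neg_abs_le (F ⟨y₀, hy₀⟩), le_abs_self (F ⟨y₀, hy₀⟩)]
  have hδ0 : Tendsto δ atTop (nhds 0) := by
    have := (tendsto_pow_atTop_nhds_zero_of_lt_one (r := (1 / 2 : ℝ)) (by norm_num)
      (by norm_num)).const_mul ε
    simpa [hδdef, div_eq_mul_inv] using this
  have h2a : ∀ n, 2 * δ (n + 1) < a := fun n => by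
    rw [hδ2]
    exact (hδε n).trans_lt hεa
  have hc : ∀ n, 8 * L * ε / 2 ^ (n + 1) = 8 * L * δ (n + 1) := fun n => by
    simp only [hδdef]
    ring
  have hlim : ∀ x, ∃ l, Tendsto (fun n => u n x) atTop (nhds l) := by
    intro x
    rcases sq_le_or_le_sq ha hpos h0 hlog with h | h
    · refine exists_tendsto_of_le_add (hbound x) (c := 8 * L * ε) (by positivity) fun n => ?_
      rw [hc]
      have hsq := h _ (hδ (n + 1)) (h2a n)
      rw [hδ2] at hsq
      refine le_of_double_step hX (hρ0 (n + 1)) hsq (hδ _) (hb _) (hb _) ⟨y₀, hy₀⟩ (hh _).1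
        (by rw [hδ2]; exact (hh n).2) hL.le (fun x y _ => hLip _ x y) (fun x y _ => ?_)
        (fun y hy => (huF _ ⟨y, hy⟩).trans (huF _ ⟨y, hy⟩).symm) x
      rw [hδ2, dist_comm]
      exact hLip n y x
    · obtain ⟨l, hl⟩ := exists_tendsto_of_le_add (f := fun n => -u n x)
        (fun n => by rw [abs_neg]; exact hbound x n) (c := 8 * L * ε) (by positivity) (fun n => by
          rw [hc]
          have hsq := h _ (hδ (n + 1)) (h2a n)
          rw [hδ2] at hsq
          refine le_of_double_step (u := -u (n + 1)) (v := -u n) hX (inv_pos.2 (hρ0 (n + 1)))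
            (ρ₂ := (ρ (δ n))⁻¹)
            (by rw [inv_pow]; exact inv_anti₀ (hρ0 n) hsq) (hδ _) (hb _).neg (hb _).neg
            ⟨y₀, hy₀⟩ ((hh _).2.neg (hρ0 _)) (by rw [hδ2]; exact (hh n).1.neg (hρ0 _)) hL.le
            (fun x y _ => ?_) (fun x y _ => ?_)
            (fun y hy => congrArg Neg.neg ((huF _ ⟨y, hy⟩).trans (huF _ ⟨y, hy⟩).symm)) x
          · have := hLip (n + 1) y x
            rw [dist_comm] at this
            simp only [Pi.neg_apply]
            linarith
          · have := hLip n x y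
            rw [hδ2]
            simp only [Pi.neg_apply]
            linarith)
      exact ⟨-l, by simpa using hl.neg⟩
  choose v hv using hlim
  exact ⟨v, tendstoUniformly_of_almost_lipschitz hδ0 hL hLip hv⟩
end

section
/- Let β ≠ 0, n ≥ 1, x₀ ∈ ℝⁿ, A > 0 and B ∈ ℝ, and let φ : ℝⁿ → ℝ be either the positive β-exponential cone φ(x) = sgn(β)·A·(1−e^{−β‖x−x₀‖}) + B or the negative β-exponential cone φ(x) = sgn(β)·A·(1−e^{β‖x−x₀‖}) + B, where ‖·‖ is the Euclidean norm. Then for every x ≠ x₀, φ is smooth in a neighbourhood of x, ∇φ(x) ≠ 0, and |∇φ(x)|^{−2} · Σ_{i,j=1}^{n} ∂_iφ(x)·∂_i∂_jφ(x)·∂_jφ(x) + β·|∇φ(x)| = 0; that is, φ is a classical solution of Δ_∞φ + β|∇φ| = 0 on ℝⁿ∖{x₀}. -/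
open Set

noncomputable section

section Radial

variable {E : Type*} [NormedAddCommGroup E] [InnerProductSpace ℝ E]

theorem hasFDerivAt_norm_sub {x₀ x : E} (hx : x ≠ x₀) :
    HasFDerivAt (fun y => ‖y - x₀‖) (‖x - x₀‖⁻¹ • innerSL ℝ (x - x₀)) x := by
  have hr : ‖x - x₀‖ ≠ 0 := norm_ne_zero_iff.2 (sub_ne_zero.2 hx)
  have h1 : HasFDerivAt (fun y => ‖y - x₀‖ ^ 2) (2 • innerSL ℝ (x - x₀)) x := by
    simpa using ((hasFDerivAt_id x).sub_const x₀).norm_sq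
  have h2 := h1.sqrt (pow_ne_zero 2 hr)
  simp only [Real.sqrt_sq (norm_nonneg _)] at h2
  convert h2 using 1
  ext v
  simp
  field_simp

/-- The gradient of a radial function `g ‖y - x₀‖` points along `y - x₀`. -/
theorem hasFDerivAt_radial {g : ℝ → ℝ} {a : ℝ} {x₀ x : E} (hx : x ≠ x₀)
    (hg : HasDerivAt g a ‖x - x₀‖) :
    HasFDerivAt (fun y => g ‖y - x₀‖) ((a * ‖x - x₀‖⁻¹) • innerSL ℝ (x - x₀)) x := by
  simpa [Function.comp_def, smul_smul] using hg.comp_hasFDerivAt x (hasFDerivAt_norm_sub hx)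

theorem gradient_radial [CompleteSpace E] {g : ℝ → ℝ} {a : ℝ} {x₀ x : E} (hx : x ≠ x₀)
    (hg : HasDerivAt g a ‖x - x₀‖) :
    gradient (fun y => g ‖y - x₀‖) x = (a * ‖x - x₀‖⁻¹) • (x - x₀) := by
  apply HasGradientAt.gradient
  rw [hasGradientAt_iff_hasFDerivAt]
  have h : InnerProductSpace.toDual ℝ E ((a * ‖x - x₀‖⁻¹) • (x - x₀)) =
      (a * ‖x - x₀‖⁻¹) • innerSL ℝ (x - x₀) := by
    ext v
    simp only [InnerProductSpace.toDual_apply_apply, smul_apply,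
      innerSL_apply_apply, real_inner_smul_left, smul_eq_mul]
  exact h ▸ hasFDerivAt_radial hx hg

theorem norm_gradient_radial [CompleteSpace E] {g : ℝ → ℝ} {a : ℝ} {x₀ x : E} (hx : x ≠ x₀)
    (hg : HasDerivAt g a ‖x - x₀‖) :
    ‖gradient (fun y => g ‖y - x₀‖) x‖ = |a| := by
  have hr : ‖x - x₀‖ ≠ 0 := norm_ne_zero_iff.2 (sub_ne_zero.2 hx)
  rw [gradient_radial hx hg, norm_smul, Real.norm_eq_abs, abs_mul, abs_inv, abs_norm, mul_assoc,
    inv_mul_cancel₀ hr, mul_one]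

theorem fderiv_fderiv_radial {g g' : ℝ → ℝ} {b : ℝ} {x₀ x : E} (hx : x ≠ x₀)
    (hg : ∀ r, HasDerivAt g (g' r) r) (hg' : HasDerivAt g' b ‖x - x₀‖) (v w : E) :
    fderiv ℝ (fun y => fderiv ℝ (fun z => g ‖z - x₀‖) y w) x v =
      g' ‖x - x₀‖ * ‖x - x₀‖⁻¹ * inner ℝ v w +
        (b - g' ‖x - x₀‖ * ‖x - x₀‖⁻¹) * (‖x - x₀‖⁻¹) ^ 2 *
          (inner ℝ (x - x₀) v * inner ℝ (x - x₀) w) := by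
  have hr : ‖x - x₀‖ ≠ 0 := norm_ne_zero_iff.2 (sub_ne_zero.2 hx)
  have hev : (fun y => fderiv ℝ (fun z => g ‖z - x₀‖) y w) =ᶠ[nhds x]
      fun y => (g' ‖y - x₀‖ * ‖y - x₀‖⁻¹) * inner ℝ (y - x₀) w := by
    filter_upwards [isOpen_ne.mem_nhds hx] with y hy
    rw [(hasFDerivAt_radial hy (hg _)).fderiv]
    simp only [smul_apply, innerSL_apply_apply, smul_eq_mul]
  have h1 := hasFDerivAt_radial hx
    (show HasDerivAt (fun r => g' r * r⁻¹) _ _ from hg'.mul (hasDerivAt_inv hr))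
  have h2 : HasFDerivAt (fun y => inner ℝ (y - x₀) w) (innerSL ℝ w) x := by
    have := (innerSL ℝ w).hasFDerivAt.comp x ((hasFDerivAt_id x).sub_const x₀)
    simpa [Function.comp_def, real_inner_comm] using this
  have h3 : HasFDerivAt (fun y => (g' ‖y - x₀‖ * ‖y - x₀‖⁻¹) * inner ℝ (y - x₀) w) _ x := h1.mul h2
  rw [hev.fderiv_eq, h3.fderiv]
  simp only [add_apply, smul_apply, innerSL_apply_apply, smul_eq_mul, real_inner_comm v w]
  field_simp
  ring

end Radial

/-- For a radial function, the infinity Laplacian is the second derivative of its profile. -/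
theorem infinityLaplacian_radial {n : ℕ} {g g' : ℝ → ℝ} {b : ℝ}
    {x₀ x : EuclideanSpace ℝ (Fin n)} (hx : x ≠ x₀)
    (hg : ∀ r, HasDerivAt g (g' r) r) (hg' : HasDerivAt g' b ‖x - x₀‖)
    (h0 : g' ‖x - x₀‖ ≠ 0) :
    (‖gradient (fun y => g ‖y - x₀‖) x‖ ^ 2)⁻¹ *
      (∑ i : Fin n, ∑ j : Fin n,
        fderiv ℝ (fun y => g ‖y - x₀‖) x (EuclideanSpace.single i 1) *
          fderiv ℝ (fun y => fderiv ℝ (fun y => g ‖y - x₀‖) y (EuclideanSpace.single j 1)) x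
            (EuclideanSpace.single i 1) *
          fderiv ℝ (fun y => g ‖y - x₀‖) x (EuclideanSpace.single j 1)) = b := by
  have hr : ‖x - x₀‖ ≠ 0 := norm_ne_zero_iff.2 (sub_ne_zero.2 hx)
  have hsum : ∑ i, (x - x₀) i * (x - x₀) i = ‖x - x₀‖ ^ 2 := by
    rw [EuclideanSpace.real_norm_sq_eq]
    exact Finset.sum_congr rfl fun i _ => (sq _).symm
  have hquad (c d : ℝ) : ∑ i, ∑ j, (x - x₀) i * (c * inner ℝ
      (EuclideanSpace.single i (1 : ℝ)) (EuclideanSpace.single j (1 : ℝ)) +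
        d * ((x - x₀) i * (x - x₀) j)) * (x - x₀) j =
      c * ‖x - x₀‖ ^ 2 + d * (‖x - x₀‖ ^ 2) ^ 2 := by
    have : ∀ i j, (x - x₀) i * (c * inner ℝ
        (EuclideanSpace.single i (1 : ℝ)) (EuclideanSpace.single j (1 : ℝ)) +
          d * ((x - x₀) i * (x - x₀) j)) * (x - x₀) j =
        (if i = j then c * ((x - x₀) i * (x - x₀) j) else 0) +
          d * (((x - x₀) i * (x - x₀) i) * ((x - x₀) j * (x - x₀) j)) := by
      intro i j
      rw [EuclideanSpace.inner_single_left]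
      by_cases h : i = j
      · subst h
        simp
        ring
      · simp [h]
        ring
    simp only [this, Finset.sum_add_distrib, Finset.sum_ite_eq, Finset.mem_univ, if_true,
      ← Finset.mul_sum]
    rw [sq (‖x - x₀‖ ^ 2), ← hsum, Finset.sum_mul_sum]
    simp only [Finset.mul_sum]
  have hterm (i : Fin n) : inner ℝ (x - x₀) (EuclideanSpace.single i (1 : ℝ)) = (x - x₀) i := by
    simp [EuclideanSpace.inner_single_right]
  set a := g' ‖x - x₀‖ with ha
  set r := ‖x - x₀‖ with hrdef
  have hall : ∀ i j : Fin n, fderiv ℝ (fun y => g ‖y - x₀‖) x (EuclideanSpace.single i 1) *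
          fderiv ℝ (fun y => fderiv ℝ (fun y => g ‖y - x₀‖) y (EuclideanSpace.single j 1)) x
            (EuclideanSpace.single i 1) *
          fderiv ℝ (fun y => g ‖y - x₀‖) x (EuclideanSpace.single j 1) =
      (a * r⁻¹) ^ 2 * ((x - x₀) i * (a * r⁻¹ * inner ℝ
        (EuclideanSpace.single i (1 : ℝ)) (EuclideanSpace.single j (1 : ℝ)) +
          ((b - a * r⁻¹) * r⁻¹ ^ 2) * ((x - x₀) i * (x - x₀) j)) * (x - x₀) j) := by
    intro i j
    rw [fderiv_fderiv_radial hx hg hg', (hasFDerivAt_radial hx (hg _)).fderiv]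
    simp only [smul_apply, innerSL_apply_apply, smul_eq_mul, hterm]
    ring
  simp only [hall, ← Finset.mul_sum]
  rw [hquad, norm_gradient_radial hx (hg _), sq_abs, ← hrdef, ← ha]
  field_simp
  ring

/-- Both exponential cones have this form, with `γ = -β` or `γ = β`. -/
theorem exp_radial_is_classical_solution {n : ℕ} {β γ C : ℝ} (B : ℝ)
    (h0 : C * γ ≠ 0) (h : C * γ ^ 2 = β * |C * γ|)
    {x₀ x : EuclideanSpace ℝ (Fin n)} (hx : x ≠ x₀)
    {φ : EuclideanSpace ℝ (Fin n) → ℝ}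
    (hφ : ∀ x, φ x = C * (1 - Real.exp (γ * ‖x - x₀‖)) + B) :
      (∃ s, IsOpen s ∧ x ∈ s ∧ ContDiffOn ℝ (⊤ : ℕ∞) φ s) ∧
      gradient φ x ≠ 0 ∧
      (‖gradient φ x‖ ^ 2)⁻¹ *
        (∑ i : Fin n, ∑ j : Fin n,
          fderiv ℝ φ x (EuclideanSpace.single i 1) *
            fderiv ℝ (fun y => fderiv ℝ φ y (EuclideanSpace.single j 1)) x
              (EuclideanSpace.single i 1) *
            fderiv ℝ φ x (EuclideanSpace.single j 1)) +
        β * ‖gradient φ x‖ = 0 := by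
  have hexp (r : ℝ) : HasDerivAt (fun t => Real.exp (γ * t)) (γ * Real.exp (γ * r)) r := by
    simpa [mul_comm] using ((hasDerivAt_id r).const_mul γ).exp
  have hg (r : ℝ) : HasDerivAt (fun t => C * (1 - Real.exp (γ * t)) + B)
      (-(C * γ) * Real.exp (γ * r)) r := by
    exact ((((hexp r).const_sub 1).const_mul C).add_const B).congr_deriv (by ring)
  have hg' : HasDerivAt (fun r => -(C * γ) * Real.exp (γ * r))
      (-(C * γ ^ 2) * Real.exp (γ * ‖x - x₀‖)) ‖x - x₀‖ := by
    exact ((hexp ‖x - x₀‖).const_mul (-(C * γ))).congr_deriv (by ring)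
  have hne : -(C * γ) * Real.exp (γ * ‖x - x₀‖) ≠ 0 :=
    mul_ne_zero (neg_ne_zero.2 h0) (Real.exp_ne_zero _)
  obtain rfl : φ = fun x => C * (1 - Real.exp (γ * ‖x - x₀‖)) + B := funext hφ
  have hnorm := norm_gradient_radial hx (hg ‖x - x₀‖)
  refine ⟨⟨{x₀}ᶜ, isOpen_compl_singleton, hx, fun y hy => ?_⟩, ?_, ?_⟩
  · have hn : ContDiffAt ℝ (⊤ : ℕ∞) (fun y => ‖y - x₀‖) y :=
      (contDiffAt_id.sub contDiffAt_const).norm ℝ (sub_ne_zero.2 hy)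
    exact ((contDiffAt_const.mul (contDiffAt_const.sub
      (contDiffAt_const.mul hn).exp)).add contDiffAt_const).contDiffWithinAt
  · rw [← norm_ne_zero_iff, hnorm]
    exact abs_ne_zero.2 hne
  · rw [infinityLaplacian_radial hx hg hg' hne, hnorm, abs_mul, abs_neg, Real.abs_exp, h]
    ring

/-- Every β-exponential cone `φ` on `ℝⁿ` (Euclidean distance, slope `A > 0`)
is, away from its center `x₀`, smooth with nonvanishing gradient and a classical solution of
`Δ_∞φ + β|∇φ| = 0`, i.e.
`|∇φ|⁻²·Σ_{i,j} ∂_iφ·∂_i∂_jφ·∂_jφ + β·|∇φ| = 0`. -/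
theorem exp_cone_is_classical_solution (n : ℕ) (hn : 1 ≤ n) (β : ℝ) (hβ : β ≠ 0)
    (x₀ : EuclideanSpace ℝ (Fin n)) (A B : ℝ) (hA : 0 < A)
    (φ : EuclideanSpace ℝ (Fin n) → ℝ)
    (hφ : (∀ x, φ x = Real.sign β * A * (1 - Real.exp (-β * ‖x - x₀‖)) + B) ∨
          (∀ x, φ x = Real.sign β * A * (1 - Real.exp (β * ‖x - x₀‖)) + B)) :
    ∀ x : EuclideanSpace ℝ (Fin n), x ≠ x₀ →
      (∃ s, IsOpen s ∧ x ∈ s ∧ ContDiffOn ℝ (⊤ : ℕ∞) φ s) ∧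
      gradient φ x ≠ 0 ∧
      (‖gradient φ x‖ ^ 2)⁻¹ *
        (∑ i : Fin n, ∑ j : Fin n,
          fderiv ℝ φ x (EuclideanSpace.single i 1) *
            fderiv ℝ (fun y => fderiv ℝ φ y (EuclideanSpace.single j 1)) x
              (EuclideanSpace.single i 1) *
            fderiv ℝ φ x (EuclideanSpace.single j 1)) +
        β * ‖gradient φ x‖ = 0 := by
  intro x hx
  have hs : Real.sign β * A * β ≠ 0 :=
    mul_ne_zero (mul_ne_zero (mt Real.sign_eq_zero_iff.1 hβ) hA.ne') hβ
  have habs : Real.sign β * A * β ^ 2 = β * |Real.sign β * A * β| := by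
    rcases hβ.lt_or_gt with h | h
    · rw [Real.sign_of_neg h, abs_of_pos (by nlinarith)]
      ring
    · rw [Real.sign_of_pos h, abs_of_pos (by nlinarith)]
      ring
  rcases hφ with hφ | hφ
  · refine exp_radial_is_classical_solution B ?_ ?_ hx hφ
    · rwa [mul_neg, neg_ne_zero]
    · rwa [mul_neg, abs_neg, neg_sq]
  · exact exp_radial_is_classical_solution B hs habs hx hφ

end
end

section
/- Let β ≠ 0. For every A ≥ 0 the function u_A : [0,∞) → ℝ defined by u_A(x) = sgn(β)·A·(1−e^{−|β|x}) is bounded, satisfies u_A(0) = 0, is twice differentiable on (0,∞), and satisfies u_A″(x) + β·|u_A′(x)| = 0 for every x > 0. In particular, distinct values of A ≥ 0 give distinct functions, so the boundary value problem u″ + β|u′| = 0 on (0,∞) with u(0) = 0 has infinitely many bounded classical solutions. -/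
open Set

theorem hasDerivAt_const_mul_one_sub_exp (c k x : ℝ) :
    HasDerivAt (fun t => c * (1 - Real.exp (k * t))) (-(c * k) * Real.exp (k * x)) x := by
  have h := ((((hasDerivAt_id' x).const_mul k).exp).const_sub 1).const_mul c
  exact h.congr_deriv (by ring)

theorem deriv_const_mul_one_sub_exp (c k : ℝ) :
    deriv (fun t => c * (1 - Real.exp (k * t))) = fun t => -(c * k) * Real.exp (k * t) :=
  funext fun x => (hasDerivAt_const_mul_one_sub_exp c k x).deriv

theorem hasDerivAt_const_mul_exp_mul (c k x : ℝ) :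
    HasDerivAt (fun t => c * Real.exp (k * t)) (c * k * Real.exp (k * x)) x := by
  have h := (((hasDerivAt_id' x).const_mul k).exp).const_mul c
  exact h.congr_deriv (by ring)

theorem Real.sign_mul_abs_self (r : ℝ) : Real.sign r * |r| = r := by
  rcases lt_trichotomy r 0 with h | rfl | h
  · rw [Real.sign_of_neg h, abs_of_neg h]; ring
  · simp
  · rw [Real.sign_of_pos h, abs_of_pos h, one_mul]

/-- For `β ≠ 0`, every `u_A(x) = sgn(β)·A·(1 − e^{−|β|x})` with `A ≥ 0` is a
bounded classical solution of `u″ + β|u′| = 0` on `(0,∞)` with `u_A(0) = 0`, and distinct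
`A`'s give distinct functions: the boundary value problem has infinitely many bounded
solutions. -/
theorem one_dimensional_nonuniqueness (β : ℝ) (hβ : β ≠ 0) :
    (∀ A : ℝ, 0 ≤ A →
      (∃ C : ℝ, ∀ x : ℝ, x ∈ Ici (0 : ℝ) →
        |Real.sign β * A * (1 - Real.exp (-|β| * x))| ≤ C) ∧
      Real.sign β * A * (1 - Real.exp (-|β| * 0)) = 0 ∧
      (∀ x : ℝ, 0 < x →
        DifferentiableAt ℝ (fun t => Real.sign β * A * (1 - Real.exp (-|β| * t))) x ∧
        DifferentiableAt ℝ
          (deriv (fun t => Real.sign β * A * (1 - Real.exp (-|β| * t)))) x) ∧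
      (∀ x : ℝ, 0 < x →
        deriv (deriv (fun t => Real.sign β * A * (1 - Real.exp (-|β| * t)))) x +
          β * |deriv (fun t => Real.sign β * A * (1 - Real.exp (-|β| * t))) x| = 0)) ∧
    (∀ A A' : ℝ, 0 ≤ A → 0 ≤ A' → A ≠ A' →
      (fun x : ℝ => Real.sign β * A * (1 - Real.exp (-|β| * x))) ≠
      (fun x : ℝ => Real.sign β * A' * (1 - Real.exp (-|β| * x)))) := by
  refine ⟨fun A hA => ⟨⟨|Real.sign β * A|, fun x hx => ?_⟩, by simp, fun x _ => ⟨?_, ?_⟩,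
    fun x _ => ?_⟩, fun A A' _ _ hne heq => hne ?_⟩
  · have hle : Real.exp (-|β| * x) ≤ 1 :=
      Real.exp_le_one_iff.2 (by nlinarith [abs_nonneg β, mem_Ici.1 hx])
    have hpos := Real.exp_pos (-|β| * x)
    rw [abs_mul]
    exact mul_le_of_le_one_right (abs_nonneg _) (abs_le.2 ⟨by linarith, by linarith⟩)
  · exact (hasDerivAt_const_mul_one_sub_exp _ _ x).differentiableAt
  · rw [deriv_const_mul_one_sub_exp]
    exact (hasDerivAt_const_mul_exp_mul _ _ x).differentiableAt
  · have hc : -(Real.sign β * A * -|β|) = β * A := by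
      linear_combination A * Real.sign_mul_abs_self β
    rw [deriv_const_mul_one_sub_exp, hc, (hasDerivAt_const_mul_exp_mul _ _ x).deriv, abs_mul,
      abs_mul, abs_of_nonneg hA, Real.abs_exp]
    ring
  · have h1 := congrFun heq 1
    have hexp : 1 - Real.exp (-|β| * 1) ≠ 0 := by
      have : Real.exp (-|β| * 1) < 1 := Real.exp_lt_one_iff.2 (by linarith [abs_pos.2 hβ])
      linarith
    have hsign : Real.sign β ≠ 0 := fun h => hβ (Real.sign_eq_zero_iff.1 h)
    exact mul_left_cancel₀ hsign (mul_right_cancel₀ hexp h1)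
end

section
/- Let X be a compact length space, Y ⊆ X a closed subset, β > 0, ε > 0, and θ ∈ [0,1) with (1+θ)/2 ≥ 1/(1+e^{−βε}). Let w : X → ℝ be continuous and satisfy comparison with β-exponential cones from above (CECA) on X∖Y. Then for every z ∈ X whose closed 2ε-ball is contained in X∖Y, and every x in the open ball B_ε(z): w(x) ≤ ((1+θ)/2)·sup_{y ∈ B_{2ε}(z)} w(y) + ((1−θ)/2)·w(z). -/
open Set Metric Filter

/-- A positive exponential cone at `z` with value `w z` at the centre and `M` at distance `R`
bounds a function with `w ≤ M` on `ball z R` that satisfies comparison from above. -/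
lemma CECA.le_cone {X : Type*} [MetricSpace X] [CompactSpace X] {Y : Set X}
    (hYcl : IsClosed Y) {β R M : ℝ} (hβ : 0 < β) (hR : 0 < R) {w : X → ℝ} (hw : Continuous w)
    (hCECA : CECA β Y w) {z : X} (hz : closedBall z R ⊆ Yᶜ) (hM : ∀ y ∈ ball z R, w y ≤ M)
    {x : X} (hx : x ∈ ball z R) :
    w x ≤ (M - w z) / (1 - Real.exp (-β * R)) * (1 - Real.exp (-β * dist z x)) + w z := by
  have hpos : 0 < 1 - Real.exp (-β * R) := by
    have : Real.exp (-β * R) < 1 := Real.exp_lt_one_iff.2 (by nlinarith)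
    linarith
  have hMz : 0 ≤ M - w z := sub_nonneg.2 (hM z (mem_ball_self hR))
  have hclosure : ∀ y ∈ closure (ball z R), w y ≤ M := fun y hy =>
    closure_minimal hM (isClosed_le hw continuous_const) hy
  have hsep : ∃ r > 0, ∀ v ∈ ball z R, ∀ y ∈ Y, r ≤ dist v y := by
    obtain ⟨r, hr, h⟩ := Metric.exists_pos_forall_lt_edist
      (isClosed_closedBall (x := z) (ε := R)).isCompact hYcl (disjoint_left.2 hz)
    refine ⟨r, hr, fun v hv y hy => ?_⟩
    have := h v (ball_subset_closedBall hv) y hy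
    rw [edist_nndist] at this
    exact_mod_cast this.le
  refine hCECA (ball z R) isOpen_ball (ball_subset_closedBall.trans hz) hsep z
    (fun x => (M - w z) / (1 - Real.exp (-β * R)) * (1 - Real.exp (-β * dist z x)) + w z)
    ⟨(M - w z) / (1 - Real.exp (-β * R)), w z, by positivity, Or.inl fun y => ?_⟩ ?_ x hx
  · rw [Real.sign_of_pos hβ, one_mul]
  · intro y hy
    rw [(isOpen_ball.sdiff isClosed_singleton).frontier_eq] at hy
    obtain ⟨hy₁, hy₂⟩ := hy
    have hyc : y ∈ closure (ball z R) := closure_mono sdiff_subset hy₁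
    by_cases hyz : y = z
    · simp [hyz]
    · have hyR : y ∉ ball z R := fun h => hy₂ ⟨h, hyz⟩
      have hle : dist y z ≤ R := closure_ball_subset_closedBall hyc
      have hd : dist z y = R := by
        rw [dist_comm]
        exact le_antisymm hle (not_lt.1 hyR)
      simp only [hd]
      rw [div_mul_cancel₀ _ hpos.ne']
      linarith [hclosure y hyc]

/-- If `w` is continuous and satisfies CECA on `X∖Y`, and the bias satisfies
`(1+θ)/2 ≥ 1/(1+e^{−βε})`, then for every `z` whose closed `2ε`-ball avoids `Y` and every `x`
in the open `ε`-ball around `z`: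
`w(x) ≤ ((1+θ)/2)·sup_{B_{2ε}(z)} w + ((1−θ)/2)·w(z)`. -/
theorem CECA_implies_submean_inequality
    {X : Type*} [MetricSpace X] [CompactSpace X] (hX : IsLengthSpace X)
    (Y : Set X) (hYcl : IsClosed Y)
    (β ε θ : ℝ) (hβ : 0 < β) (hε : 0 < ε) (hθ : θ ∈ Set.Ico (0 : ℝ) 1)
    (hodds : 1 / (1 + Real.exp (-β * ε)) ≤ (1 + θ) / 2)
    (w : X → ℝ) (hw : Continuous w) (hCECA : CECA β Y w) :
    ∀ z : X, closedBall z (2 * ε) ⊆ Yᶜ → ∀ x ∈ ball z ε,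
      w x ≤ ((1 + θ) / 2) * sSup (w '' ball z (2 * ε)) + ((1 - θ) / 2) * w z := by
  intro z hz x hx
  have hbdd : BddAbove (w '' ball z (2 * ε)) :=
    (isCompact_range hw).bddAbove.mono (image_subset_range _ _)
  set M := sSup (w '' ball z (2 * ε))
  have hM : ∀ y ∈ ball z (2 * ε), w y ≤ M := fun y hy => le_csSup hbdd (mem_image_of_mem w hy)
  have hMz : 0 ≤ M - w z := sub_nonneg.2 (hM z (mem_ball_self (by positivity)))
  have hcone := hCECA.le_cone hYcl hβ (by positivity) hw hz hM
    (ball_subset_ball (by linarith) hx)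
  set q := Real.exp (-β * ε) with hq
  have hq1 : q < 1 := Real.exp_lt_one_iff.2 (by nlinarith)
  have hq0 : 0 < q := Real.exp_pos _
  have hqq : Real.exp (-β * (2 * ε)) = q * q := by
    rw [hq, ← Real.exp_add]
    ring_nf
  have hqx : q ≤ Real.exp (-β * dist z x) := by
    have : dist z x < ε := mem_ball'.1 hx
    exact Real.exp_le_exp.2 (by nlinarith)
  rw [hqq] at hcone
  have hfac : 1 - q * q = (1 - q) * (1 + q) := by ring
  have hden : 0 < 1 - q * q := by rw [hfac]; exact mul_pos (by linarith) (by linarith)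
  calc w x ≤ (M - w z) / (1 - q * q) * (1 - Real.exp (-β * dist z x)) + w z := hcone
    _ ≤ (M - w z) / (1 - q * q) * (1 - q) + w z := by gcongr
    _ = (M - w z) * (1 / (1 + q)) + w z := by
      have h₁ : 1 - q ≠ 0 := by linarith
      have h₂ : 1 + q ≠ 0 := by linarith
      rw [hfac]
      field_simp
    _ ≤ (M - w z) * ((1 + θ) / 2) + w z := by gcongr
    _ = (1 + θ) / 2 * M + (1 - θ) / 2 * w z := by ring
end
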